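/- arXiv:0912.2444 — 4 statements merged into one kernel-verified Lean document; each statement's English description precedes it below -/
import Mathlib

section
/- Fix an integer r ≥ 1. For each N with Nr even, let G(N, r) be the random r-regular multigraph on [N] obtained by taking a uniformly random perfect matching of the Nr half-edges {(i, s) : i ∈ [N], 1 ≤ s ≤ r} and projecting each matched pair {(i,s), (i',s')} to the edge {i, i'}. Let I_N denote the maximum cardinality of an independent set of G(N, r). Then there exists a constant H(r) such that I_N / N converges to H(r) with high probability as N → ∞ along integers N with Nr even. -/
open Filter
open scoped Classical

/-- A perfect matching of the `N * r` half-edges `{(i, s) : i ∈ [N], s ∈ [r]}`, encoded as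
a fixed-point-free involution pairing the half-edges. -/
abbrev Matching (N r : ℕ) :=
  {f : Fin N × Fin r → Fin N × Fin r // (∀ h, f (f h) = h) ∧ ∀ h, f h ≠ h}

/-- Probability of an event `p` when a perfect matching of the `N * r` half-edges is
chosen uniformly at random (the configuration model for the random `r`-regular
multigraph on `[N]`). -/
noncomputable def probReg (N r : ℕ) (p : Matching N r → Prop) : ℝ :=
  (((Finset.univ : Finset (Matching N r)).filter p).card : ℝ) /
    (Fintype.card (Matching N r) : ℝ)

/-- The maximum cardinality of an independent set of the projected multigraph: `S` is
independent iff no matched pair of half-edges has both of its vertex projections in `S`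
(this includes self-loops). -/
noncomputable def maxIndepReg {N r : ℕ} (f : Matching N r) : ℕ :=
  Finset.sup ((Finset.univ : Finset (Finset (Fin N))).filter
    (fun S => ∀ h : Fin N × Fin r, ¬(h.1 ∈ S ∧ (f.1 h).1 ∈ S))) Finset.card
section IndependenceNumber

variable {X V : Type*}

/-- `S` contains no edge of the graph whose edges are the images under the labelling `w` of the
non-trivial orbits `{x, f x}` of the partial matching `f`. -/
def IsIndep (w : X → V) (f : X → X) (S : Finset V) : Prop :=
  ∀ x, f x ≠ x → ¬(w x ∈ S ∧ w (f x) ∈ S)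

/-- The independence number of the graph obtained from the partial matching `f` by the
labelling `w`. -/
noncomputable def indepNum [Fintype V] (w : X → V) (f : X → X) : ℕ :=
  (Finset.univ.filter (IsIndep w f)).sup Finset.card

/-- The label of `x` lies in every maximum independent set. -/
def InCore [Fintype V] (w : X → V) (f : X → X) (x : X) : Prop :=
  ∀ S, IsIndep w f S → S.card = indepNum w f → w x ∈ S

theorem IsIndep.mono {w : X → V} {f : X → X} {S T : Finset V} (hS : IsIndep w f S) (h : T ⊆ S) :
    IsIndep w f T :=
  fun x hx hT => hS x hx ⟨h hT.1, h hT.2⟩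

theorem isIndep_comp_swap [DecidableEq X] {f : X → X} {x y : X} (hf : f.Injective) (hx : f x = x)
    (hy : f y = y) (w : X → V) (S : Finset V) :
    IsIndep (w ∘ Equiv.swap x y) f S ↔ IsIndep w f S := by
  refine forall_congr' fun t => imp_congr_right fun ht => ?_
  have htx : t ≠ x := by rintro rfl; exact ht hx
  have hty : t ≠ y := by rintro rfl; exact ht hy
  have hfx : f t ≠ x := fun h => htx (hf (h.trans hx.symm))
  have hfy : f t ≠ y := fun h => hty (hf (h.trans hy.symm))
  simp [Equiv.swap_apply_of_ne_of_ne, *]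

theorem mul_swap_apply [DecidableEq X] {f : Equiv.Perm X} {x y : X} (hx : f x = x) (hy : f y = y)
    (t : X) : (f * Equiv.swap x y) t = if t = x then y else if t = y then x else f t := by
  rw [Equiv.Perm.mul_apply, Equiv.swap_apply_def]
  split_ifs <;> simp [hx, hy]

theorem isIndep_mul_swap [DecidableEq X] {f : Equiv.Perm X} {x y : X} (hxy : x ≠ y) (hx : f x = x)
    (hy : f y = y) (w : X → V) (S : Finset V) :
    IsIndep w ⇑(f * Equiv.swap x y) S ↔ IsIndep w f S ∧ ¬(w x ∈ S ∧ w y ∈ S) := by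
  constructor
  · intro h
    refine ⟨fun t ht => ?_, ?_⟩
    · have htx : t ≠ x := by rintro rfl; exact ht hx
      have hty : t ≠ y := by rintro rfl; exact ht hy
      simpa [mul_swap_apply hx hy, htx, hty, ht] using h t
    · simpa [mul_swap_apply hx hy, hxy.symm] using h x
  · rintro ⟨h, h'⟩ t ht
    by_cases htx : t = x
    · subst htx; simpa [mul_swap_apply hx hy] using h'
    by_cases hty : t = y
    · subst hty
      simpa [mul_swap_apply hx hy, hxy.symm, and_comm] using h'
    · simp only [mul_swap_apply hx hy, htx, hty, if_false] at ht ⊢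
      exact h t ht

variable [Fintype V]

theorem IsIndep.card_le_indepNum {w : X → V} {f : X → X} {S : Finset V} (hS : IsIndep w f S) :
    S.card ≤ indepNum w f :=
  Finset.le_sup (f := Finset.card) (by simpa using hS)

theorem exists_isIndep_card_eq (w : X → V) (f : X → X) :
    ∃ S, IsIndep w f S ∧ S.card = indepNum w f := by
  obtain ⟨S, hS, h⟩ := Finset.exists_mem_eq_sup (Finset.univ.filter (IsIndep w f))
    ⟨∅, by simp [IsIndep]⟩ Finset.card
  exact ⟨S, by simpa using hS, h.symm⟩

theorem indepNum_le_card (w : X → V) (f : X → X) : indepNum w f ≤ Fintype.card V := by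
  obtain ⟨S, -, h⟩ := exists_isIndep_card_eq w f
  exact h ▸ S.card_le_univ

theorem indepNum_congr {X' V' : Type*} [Fintype V'] (w : X → V) (f : X → X) (w' : X' → V')
    (f' : X' → X') (e : V ≃ V')
    (h : ∀ S, IsIndep w f S ↔ IsIndep w' f' (S.map e.toEmbedding)) :
    indepNum w f = indepNum w' f' := by
  apply le_antisymm
  · obtain ⟨S, hS, hc⟩ := exists_isIndep_card_eq w f
    simpa [hc] using ((h S).1 hS).card_le_indepNum
  · obtain ⟨S, hS, hc⟩ := exists_isIndep_card_eq w' f'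
    have : (S.map e.symm.toEmbedding).map e.toEmbedding = S := by
      ext; simp
    have := ((h (S.map e.symm.toEmbedding)).2 (by rwa [this])).card_le_indepNum
    simpa [hc] using this

theorem indepNum_comp_equiv {X' : Type*} (e : X' ≃ X) (w : X → V) (f : Equiv.Perm X') :
    indepNum (w ∘ e) f = indepNum w (e.permCongr f) := by
  refine indepNum_congr _ _ _ _ (Equiv.refl V) fun S => ?_
  simp only [IsIndep, e.forall_congr_left]
  simp [Equiv.permCongr_apply, Equiv.eq_symm_apply]

theorem indepNum_equiv_comp {V' : Type*} [Fintype V'] (e : V ≃ V') (w : X → V) (f : X → X) :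
    indepNum (e ∘ w) f = indepNum w f := by
  refine (indepNum_congr _ _ _ _ e fun S => ?_).symm
  simp [IsIndep]

theorem inCore_comp_swap [DecidableEq X] {f : X → X} {x y : X} (hf : f.Injective) (hx : f x = x)
    (hy : f y = y) (w : X → V) (t : X) :
    InCore (w ∘ Equiv.swap x y) f t ↔ InCore w f (Equiv.swap x y t) := by
  have h : indepNum (w ∘ Equiv.swap x y) f = indepNum w f :=
    indepNum_congr _ _ _ _ (Equiv.refl V) fun S => by
      simpa using isIndep_comp_swap hf hx hy w S
  simp only [InCore, isIndep_comp_swap hf hx hy, h, Function.comp]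

/-- Relabelling two points by a transposition changes the independence number by at most two. -/
theorem indepNum_le_comp_swap_add_two [DecidableEq X] (w : X → V) (f : X → X) (a b : X) :
    indepNum w f ≤ indepNum (w ∘ Equiv.swap a b) f + 2 := by
  obtain ⟨S, hS, hc⟩ := exists_isIndep_card_eq w f
  have key : IsIndep (w ∘ Equiv.swap a b) f (S \ {w a, w b}) := by
    rintro t ht ⟨h1, h2⟩
    simp only [Function.comp, Finset.mem_sdiff, Finset.mem_insert, Finset.mem_singleton,
      not_or] at h1 h2
    have h : ∀ u, w (Equiv.swap a b u) ≠ w a → w (Equiv.swap a b u) ≠ w b →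
        Equiv.swap a b u = u := by
      intro u hu hu'
      refine Equiv.swap_apply_of_ne_of_ne ?_ ?_ <;> rintro rfl <;> simp at hu hu'
    rw [h _ h1.2.1 h1.2.2] at h1
    rw [h _ h2.2.1 h2.2.2] at h2
    exact hS t ht ⟨h1.1, h2.1⟩
  have h1 := key.card_le_indepNum
  have h2 : S.card ≤ (S \ {w a, w b}).card + ({w a, w b} : Finset V).card := by
    have := Finset.le_card_sdiff ({w a, w b} : Finset V) S
    omega
  have h3 : ({w a, w b} : Finset V).card ≤ 2 := Finset.card_le_two
  omega

/-- Adding an edge lowers the independence number by one if both endpoints lie in every maximum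
independent set, and leaves it unchanged otherwise. -/
theorem indepNum_mul_swap [DecidableEq X] {f : Equiv.Perm X} {x y : X} (hxy : x ≠ y)
    (hx : f x = x) (hy : f y = y) (w : X → V) :
    (indepNum w ⇑(f * Equiv.swap x y) : ℝ) = indepNum w f -
      (if InCore w f x then 1 else 0) * (if InCore w f y then 1 else 0) := by
  obtain ⟨S, hS, hc⟩ := exists_isIndep_card_eq w f
  obtain ⟨T, hT, hTc⟩ := exists_isIndep_card_eq w ⇑(f * Equiv.swap x y)
  have hT' := (isIndep_mul_swap hxy hx hy w T).1 hT
  have hle : indepNum w ⇑(f * Equiv.swap x y) ≤ indepNum w f := hTc ▸ hT'.1.card_le_indepNum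
  by_cases hcore : InCore w f x ∧ InCore w f y
  · have h1 : indepNum w f ≤ indepNum w ⇑(f * Equiv.swap x y) + 1 := by
      have h2 : IsIndep w ⇑(f * Equiv.swap x y) (S.erase (w x)) :=
        (isIndep_mul_swap hxy hx hy w _).2 ⟨hS.mono (Finset.erase_subset _ _), by simp⟩
      have h3 := h2.card_le_indepNum
      have h4 := Finset.pred_card_le_card_erase (s := S) (a := w x)
      omega
    have h2 : indepNum w ⇑(f * Equiv.swap x y) ≠ indepNum w f := fun h =>
      hT'.2 ⟨hcore.1 T hT'.1 (hTc.trans h), hcore.2 T hT'.1 (hTc.trans h)⟩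
    have h3 : indepNum w f = indepNum w ⇑(f * Equiv.swap x y) + 1 := by omega
    simp [hcore.1, hcore.2, h3]
  · have h1 : indepNum w f ≤ indepNum w ⇑(f * Equiv.swap x y) := by
      have : ∃ S, IsIndep w f S ∧ S.card = indepNum w f ∧ ¬ (w x ∈ S ∧ w y ∈ S) := by
        by_contra! hcon
        exact hcore ⟨fun S h h' => (hcon S h h').1, fun S h h' => (hcon S h h').2⟩
      obtain ⟨S, hS, hc, hn⟩ := this
      exact hc ▸ ((isIndep_mul_swap hxy hx hy w S).2 ⟨hS, hn⟩).card_le_indepNum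
    rw [le_antisymm hle h1]
    rcases not_and_or.1 hcore with h | h <;> simp [h]

theorem indepNum_mul_swap_le [DecidableEq X] {f : Equiv.Perm X} {x y : X} (hxy : x ≠ y)
    (hx : f x = x) (hy : f y = y) (w : X → V) :
    indepNum w ⇑(f * Equiv.swap x y) ≤ indepNum w f := by
  obtain ⟨T, hT, hTc⟩ := exists_isIndep_card_eq w ⇑(f * Equiv.swap x y)
  exact hTc ▸ ((isIndep_mul_swap hxy hx hy w T).1 hT).1.card_le_indepNum

theorem indepNum_le_mul_swap_add_one [DecidableEq X] {f : Equiv.Perm X} {x y : X} (hxy : x ≠ y)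
    (hx : f x = x) (hy : f y = y) (w : X → V) :
    (indepNum w f : ℝ) ≤ indepNum w ⇑(f * Equiv.swap x y) + 1 := by
  rw [indepNum_mul_swap hxy hx hy]
  split_ifs <;> simp

/-- The independence number is superadditive under disjoint unions. -/
theorem indepNum_add_le_sum {X₁ X₂ V₁ V₂ : Type*} [Fintype V₁] [Fintype V₂] (w₁ : X₁ → V₁)
    (w₂ : X₂ → V₂) (f₁ : X₁ → X₁) (f₂ : X₂ → X₂) :
    indepNum w₁ f₁ + indepNum w₂ f₂ ≤ indepNum (Sum.map w₁ w₂) (Sum.map f₁ f₂) := by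
  obtain ⟨S, hS, hc⟩ := exists_isIndep_card_eq w₁ f₁
  obtain ⟨T, hT, hTc⟩ := exists_isIndep_card_eq w₂ f₂
  rw [← hc, ← hTc, ← Finset.card_disjSum]
  apply IsIndep.card_le_indepNum
  rintro (x | x) hx
  · simpa using hS x (by simpa using hx)
  · simpa using hT x (by simpa using hx)

end IndependenceNumber

section Exchangeability

open scoped BigOperators

/-- If the pair correlations of `[0, 1]`-valued variables are constant within two groups and
across them, then nonnegativity of the variance of the difference of the group averages bounds the
cross correlation. -/
theorem two_mul_cross_correlation_le {Ω X : Type*} [Fintype Ω] (Y : X → Ω → ℝ)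
    (hY : ∀ x, 𝔼 ω, Y x ω * Y x ω ≤ 1) {U₁ U₂ : Finset X} (hU₁ : U₁.Nonempty) (hU₂ : U₂.Nonempty)
    {a b c : ℝ} (ha : 0 ≤ a) (hb : 0 ≤ b)
    (h₁ : ∀ x ∈ U₁, ∀ y ∈ U₁, x ≠ y → 𝔼 ω, Y x ω * Y y ω = a)
    (h₂ : ∀ x ∈ U₂, ∀ y ∈ U₂, x ≠ y → 𝔼 ω, Y x ω * Y y ω = b)
    (h₁₂ : ∀ x ∈ U₁, ∀ y ∈ U₂, 𝔼 ω, Y x ω * Y y ω = c) :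
    2 * c ≤ a + b + 1 / U₁.card + 1 / U₂.card := by
  have expand : ∀ U U' : Finset X, 𝔼 ω, (∑ x ∈ U, Y x ω) * (∑ y ∈ U', Y y ω) =
      ∑ x ∈ U, ∑ y ∈ U', 𝔼 ω, Y x ω * Y y ω := by
    intro U U'
    simp_rw [Finset.sum_mul_sum, Finset.expect_sum_comm]
  have diag : ∀ (U : Finset X) (a : ℝ), 0 ≤ a →
      (∀ x ∈ U, ∀ y ∈ U, x ≠ y → 𝔼 ω, Y x ω * Y y ω = a) →
      𝔼 ω, (∑ x ∈ U, Y x ω) * (∑ y ∈ U, Y y ω) ≤ (U.card : ℝ) * (U.card * a + 1) := by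
    intro U a ha h
    rw [expand, ← nsmul_eq_mul]
    refine Finset.sum_le_card_nsmul _ _ _ fun x hx => ?_
    calc ∑ y ∈ U, 𝔼 ω, Y x ω * Y y ω ≤ ∑ y ∈ U, (a + if x = y then 1 else 0) := by
          refine Finset.sum_le_sum fun y hy => ?_
          split_ifs with hxy
          · subst hxy; linarith [hY x]
          · simpa using (h x hx y hy hxy).le
      _ = U.card * a + 1 := by simp [Finset.sum_add_distrib, hx]
  have cross : 𝔼 ω, (∑ x ∈ U₁, Y x ω) * (∑ y ∈ U₂, Y y ω) = U₁.card * (U₂.card * c) := by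
    rw [expand, Finset.sum_congr rfl fun x hx => Finset.sum_congr rfl fun y hy => h₁₂ x hx y hy]
    simp
  have hn₁ : (0 : ℝ) < U₁.card := by exact_mod_cast hU₁.card_pos
  have hn₂ : (0 : ℝ) < U₂.card := by exact_mod_cast hU₂.card_pos
  have key : 0 ≤ 𝔼 ω, (U₂.card * ∑ x ∈ U₁, Y x ω - U₁.card * ∑ x ∈ U₂, Y x ω) ^ 2 :=
    Finset.expect_nonneg fun ω _ => sq_nonneg _
  have hexp : 𝔼 ω, (U₂.card * ∑ x ∈ U₁, Y x ω - U₁.card * ∑ x ∈ U₂, Y x ω) ^ 2 =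
      (U₂.card : ℝ) ^ 2 * 𝔼 ω, (∑ x ∈ U₁, Y x ω) * (∑ y ∈ U₁, Y y ω)
      + (U₁.card : ℝ) ^ 2 * 𝔼 ω, (∑ x ∈ U₂, Y x ω) * (∑ y ∈ U₂, Y y ω)
      - (2 * U₁.card * U₂.card : ℝ) * 𝔼 ω, (∑ x ∈ U₁, Y x ω) * (∑ y ∈ U₂, Y y ω) := by
    simp_rw [Finset.mul_expect, ← Finset.expect_add_distrib, ← Finset.expect_sub_distrib]
    refine Finset.expect_congr rfl fun ω _ => ?_
    ring
  rw [hexp, cross] at key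
  have e₁ := mul_le_mul_of_nonneg_left (diag U₁ a ha h₁) (sq_nonneg (U₂.card : ℝ))
  have e₂ := mul_le_mul_of_nonneg_left (diag U₂ b hb h₂) (sq_nonneg (U₁.card : ℝ))
  have h3 : (U₁.card : ℝ) ^ 2 * (U₂.card : ℝ) ^ 2 * (2 * c) ≤
      (U₁.card : ℝ) ^ 2 * (U₂.card : ℝ) ^ 2 * (a + b + 1 / U₁.card + 1 / U₂.card) := by
    have : (U₁.card : ℝ) ^ 2 * (U₂.card : ℝ) ^ 2 * (a + b + 1 / U₁.card + 1 / U₂.card) =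
      (U₂.card : ℝ) ^ 2 * (U₁.card * (U₁.card * a + 1)) +
        (U₁.card : ℝ) ^ 2 * (U₂.card * (U₂.card * b + 1)) := by
      field_simp
      ring
    rw [this]
    linarith
  exact le_of_mul_le_mul_left h3 (by positivity)

variable {Ω X V : Type*} [Fintype Ω] [DecidableEq X] [Fintype V]

/-- The law of the random labelling `lab` is invariant under transpositions of points of the
same colour. -/
def Exchangeable (lab : Ω → X → V) (c : X → Bool) : Prop :=
  ∀ x y, c x = c y → ∃ e : Ω ≃ Ω, ∀ ω, lab (e ω) = lab ω ∘ Equiv.swap x y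

/-- The expected independence number of `f` under the random labelling `lab`. -/
noncomputable def meanIndepNum (lab : Ω → X → V) (f : X → X) : ℝ :=
  𝔼 ω, (indepNum (lab ω) f : ℝ)

/-- The probability that two points are both in the core. -/
noncomputable def corePair (lab : Ω → X → V) (f : X → X) (x y : X) : ℝ :=
  𝔼 ω, (if InCore (lab ω) f x then 1 else 0) * (if InCore (lab ω) f y then 1 else 0)

theorem meanIndepNum_mul_swap {f : Equiv.Perm X} {x y : X} (hxy : x ≠ y) (hx : f x = x)
    (hy : f y = y) (lab : Ω → X → V) :
    meanIndepNum lab ⇑(f * Equiv.swap x y) = meanIndepNum lab f - corePair lab f x y := by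
  rw [meanIndepNum, meanIndepNum, corePair, ← Finset.expect_sub_distrib]
  exact Finset.expect_congr rfl fun ω _ => indepNum_mul_swap hxy hx hy _

theorem Exchangeable.corePair_swap {lab : Ω → X → V} {c : X → Bool} (h : Exchangeable lab c)
    {f : X → X} (hf : f.Injective) {a b : X} (ha : f a = a) (hb : f b = b) (hab : c a = c b)
    (x y : X) : corePair lab f (Equiv.swap a b x) (Equiv.swap a b y) = corePair lab f x y := by
  obtain ⟨e, he⟩ := h a b hab
  refine Fintype.expect_equiv e _ _ fun ω => ?_
  simp only [he, inCore_comp_swap hf ha hb]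

theorem Exchangeable.corePair_eq {lab : Ω → X → V} {c : X → Bool} (h : Exchangeable lab c)
    {f : X → X} (hf : f.Injective) {x y x' y' : X} (hx : f x = x) (hy : f y = y) (hx' : f x' = x')
    (hy' : f y' = y') (hxy : x ≠ y) (hxy' : x' ≠ y') (hcx : c x = c x') (hcy : c y = c y') :
    corePair lab f x y = corePair lab f x' y' := by
  have hs : f (Equiv.swap x x' y) = Equiv.swap x x' y ∧ c (Equiv.swap x x' y) = c y := by
    by_cases hyx : y = x'
    · subst hyx; simp [hx, hcx]
    · simp [Equiv.swap_apply_of_ne_of_ne hxy.symm hyx, hy]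
  have hne : x' ≠ Equiv.swap x x' y := by
    intro h'
    rw [eq_comm, Equiv.swap_apply_eq_iff, Equiv.swap_apply_right] at h'
    exact hxy h'.symm
  rw [← h.corePair_swap hf hx hx' hcx x y, Equiv.swap_apply_left,
    ← h.corePair_swap hf hs.1 hy' (hs.2.trans hcy) x', Equiv.swap_apply_left,
    Equiv.swap_apply_of_ne_of_ne hne hxy']

/-- Up to a small error, adding a monochromatic edge of a random colour lowers the expected
independence number at least as much as adding a bichromatic edge. -/
theorem Exchangeable.meanIndepNum_add_le [Nonempty Ω] [Fintype X] {lab : Ω → X → V}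
    {c : X → Bool} (h : Exchangeable lab c)
    {f : Equiv.Perm X} {x y z w : X} (hx : f x = x) (hy : f y = y) (hz : f z = z) (hw : f w = w)
    (hxy : x ≠ y) (hzw : z ≠ w) (hcx : c x = true) (hcy : c y = true) (hcz : c z = false)
    (hcw : c w = false) :
    meanIndepNum lab ⇑(f * Equiv.swap x y) + meanIndepNum lab ⇑(f * Equiv.swap z w) ≤
      2 * meanIndepNum lab ⇑(f * Equiv.swap x z)
        + 1 / (Finset.univ.filter fun t => c t = true ∧ f t = t).card
        + 1 / (Finset.univ.filter fun t => c t = false ∧ f t = t).card := by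
  have hxz : x ≠ z := by rintro rfl; simp [hcx] at hcz
  have hnn : ∀ s t, 0 ≤ corePair lab f s t := fun s t =>
    Finset.expect_nonneg fun ω _ => by positivity
  have key := two_mul_cross_correlation_le
    (fun x ω => if InCore (lab ω) f x then (1 : ℝ) else 0)
    (fun x => Finset.expect_le Finset.univ_nonempty fun ω _ => by split_ifs <;> simp)
    (U₁ := Finset.univ.filter fun t => c t = true ∧ f t = t)
    (U₂ := Finset.univ.filter fun t => c t = false ∧ f t = t)
    ⟨x, by simp [*]⟩ ⟨z, by simp [*]⟩ (hnn x y) (hnn z w) (c := corePair lab f x z)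
    (fun s hs t ht hst => by
      simp only [Finset.mem_filter] at hs ht
      exact h.corePair_eq f.injective hs.2.2 ht.2.2 hx hy hst hxy (by simp [*]) (by simp [*]))
    (fun s hs t ht hst => by
      simp only [Finset.mem_filter] at hs ht
      exact h.corePair_eq f.injective hs.2.2 ht.2.2 hz hw hst hzw (by simp [*]) (by simp [*]))
    (fun s hs t ht => by
      simp only [Finset.mem_filter] at hs ht
      refine h.corePair_eq f.injective hs.2.2 ht.2.2 hx hz ?_ hxz (by simp [*]) (by simp [*])
      rintro rfl
      simp [hs.2.1] at ht)
  rw [meanIndepNum_mul_swap hxy hx hy, meanIndepNum_mul_swap hzw hz hw,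
    meanIndepNum_mul_swap hxz hx hz]
  linarith

end Exchangeability

section Interpolation

variable {X V : Type*} [DecidableEq X]

theorem involutive_mul_swap {f : Equiv.Perm X} (hf : Function.Involutive f) {x y : X}
    (hx : f x = x) (hy : f y = y) : Function.Involutive ⇑(f * Equiv.swap x y) := by
  intro t
  by_cases htx : t = x
  · subst htx; by_cases h : y = t <;> simp [mul_swap_apply hx hy, h, hx]
  by_cases hty : t = y
  · subst hty; simp [mul_swap_apply hx hy]
  have h1 : f t ≠ x := fun h => htx (f.injective (h.trans hx.symm))
  have h2 : f t ≠ y := fun h => hty (f.injective (h.trans hy.symm))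
  simp [mul_swap_apply hx hy, htx, hty, h1, h2, hf t]

theorem exists_eq_mul_swap {f : Equiv.Perm X} (hf : Function.Involutive f) (x : X) :
    ∃ g : Equiv.Perm X, Function.Involutive g ∧ g x = x ∧ g (f x) = f x ∧
      f = g * Equiv.swap x (f x) := by
  have hx : (f * Equiv.swap x (f x)) x = x := by simp [hf x]
  have hy : (f * Equiv.swap x (f x)) (f x) = f x := by simp
  have h : ∀ t, t ≠ x → t ≠ f x → (f * Equiv.swap x (f x)) t = f t := fun t h1 h2 => by
    simp [Equiv.swap_apply_of_ne_of_ne h1 h2]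
  refine ⟨f * Equiv.swap x (f x), fun t => ?_, hx, hy, by simp [mul_assoc]⟩
  by_cases htx : t = x
  · rw [htx, hx, hx]
  by_cases hty : t = f x
  · rw [hty, hy, hy]
  have h1 : f t ≠ x := fun h => hty (by rw [← h, hf t])
  have h2 : f t ≠ f x := fun h => htx (f.injective h)
  rw [h t htx hty, h _ h1 h2, hf t]

theorem meanIndepNum_le_mul_swap_add_one {Ω : Type*} [Fintype Ω] [Nonempty Ω]
    [Fintype V] {f : Equiv.Perm X} {x y : X} (hxy : x ≠ y) (hx : f x = x) (hy : f y = y)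
    (lab : Ω → X → V) :
    meanIndepNum lab f ≤ meanIndepNum lab ⇑(f * Equiv.swap x y) + 1 := by
  rw [meanIndepNum, meanIndepNum, ← Fintype.expect_const (ι := Ω) (1 : ℝ),
    ← Finset.expect_add_distrib]
  exact Finset.expect_le_expect fun ω _ => indepNum_le_mul_swap_add_one hxy hx hy _

variable [Fintype X]

/-- The unmatched points of colour `b`. -/
def freePoints (c : X → Bool) (f : X → X) (b : Bool) : Finset X :=
  Finset.univ.filter fun t => c t = b ∧ f t = t

/-- The points of colour `true` matched to a point of colour `false`. -/
def crossPoints (c : X → Bool) (f : X → X) : Finset X :=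
  Finset.univ.filter fun t => c t = true ∧ c (f t) = false

theorem freePoints_mul_swap (c : X → Bool) {f : Equiv.Perm X} {x y : X} (hxy : x ≠ y)
    (hx : f x = x) (hy : f y = y) (b : Bool) :
    freePoints c ⇑(f * Equiv.swap x y) b = freePoints c f b \ {x, y} := by
  ext t
  simp only [freePoints, Finset.mem_filter, Finset.mem_univ, true_and, Finset.mem_sdiff,
    Finset.mem_insert, Finset.mem_singleton, mul_swap_apply hx hy]
  by_cases htx : t = x
  · subst htx; simp [hxy.symm]
  by_cases hty : t = y
  · subst hty; simp [hxy, hxy.symm]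
  simp [htx, hty]

theorem card_freePoints_mul_swap (c : X → Bool) {f : Equiv.Perm X} {x y : X} (hxy : x ≠ y)
    (hx : f x = x) (hy : f y = y) (b : Bool) :
    (freePoints c f b).card = (freePoints c ⇑(f * Equiv.swap x y) b).card +
      ((if c x = b then 1 else 0) + if c y = b then 1 else 0) := by
  have hmx : x ∈ freePoints c f b ↔ c x = b := by simp [freePoints, hx]
  have hmy : y ∈ freePoints c f b ↔ c y = b := by simp [freePoints, hy]
  rw [freePoints_mul_swap c hxy hx hy, ← Finset.card_sdiff_add_card_inter _ {x, y}]
  congr 1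
  by_cases h1 : c x = b <;> by_cases h2 : c y = b <;>
    simp [Finset.inter_insert_of_mem, Finset.inter_insert_of_notMem, hmx, hmy, h1, h2, hxy]

theorem crossPoints_mul_swap_of_eq (c : X → Bool) {f : Equiv.Perm X} {x y : X}
    (hx : f x = x) (hy : f y = y) (hc : c x = c y) :
    crossPoints c ⇑(f * Equiv.swap x y) = crossPoints c f := by
  ext t
  simp only [crossPoints, Finset.mem_filter, Finset.mem_univ, true_and, mul_swap_apply hx hy]
  by_cases htx : t = x
  · subst htx; simp [hx, hc]
  by_cases hty : t = y
  · subst hty; simp [htx, hy, hc]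
  simp [htx, hty]

theorem card_crossPoints_mul_swap (c : X → Bool) {f : Equiv.Perm X} {x y : X}
    (hx : f x = x) (hy : f y = y) (hcx : c x = true) (hcy : c y = false) :
    (crossPoints c ⇑(f * Equiv.swap x y)).card = (crossPoints c f).card + 1 := by
  rw [← Finset.card_insert_of_notMem (a := x) (by simp [crossPoints, hx, hcx])]
  congr 1
  ext t
  simp only [crossPoints, Finset.mem_filter, Finset.mem_univ, true_and, Finset.mem_insert,
    mul_swap_apply hx hy]
  by_cases htx : t = x
  · subst htx; simp [hcx, hcy]
  by_cases hty : t = y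
  · subst hty; simp [htx, hcy]
  simp [htx, hty]

/-- Deleting a bichromatic edge from a partial matching. -/
theorem exists_delete_crossPoint (c : X → Bool) {f : Equiv.Perm X} (hf : Function.Involutive f)
    (hk : (crossPoints c f).Nonempty) :
    ∃ (g : Equiv.Perm X) (x z : X), Function.Involutive g ∧ c x = true ∧ c z = false ∧ x ≠ z ∧
      g x = x ∧ g z = z ∧ f = g * Equiv.swap x z ∧
      (crossPoints c f).card = (crossPoints c g).card + 1 ∧
      ∀ b, (freePoints c g b).card = (freePoints c f b).card + 1 := by
  obtain ⟨x, hx⟩ := hk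
  simp only [crossPoints, Finset.mem_filter, Finset.mem_univ, true_and] at hx
  obtain ⟨g, hg, hgx, hgz, hfg⟩ := exists_eq_mul_swap hf x
  have hne : x ≠ f x := fun h => by rw [← h, hx.1] at hx; simp at hx
  generalize f x = z at *
  refine ⟨g, x, z, hg, hx.1, hx.2, hne, hgx, hgz, hfg, ?_, fun b => ?_⟩
  · rw [hfg, card_crossPoints_mul_swap c hgx hgz hx.1 hx.2]
  · rw [hfg, card_freePoints_mul_swap c hne hgx hgz, hx.1, hx.2]
    cases b <;> simp

variable {Ω : Type*} [Fintype Ω] [Nonempty Ω] [Fintype V]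

/-- Deleting `j` bichromatic edges. -/
theorem exists_delete_crossPoints (lab : Ω → X → V) (c : X → Bool) {f : Equiv.Perm X}
    (hf : Function.Involutive f) (j : ℕ) (hj : j ≤ (crossPoints c f).card) :
    ∃ g : Equiv.Perm X, Function.Involutive g ∧
      (crossPoints c f).card = (crossPoints c g).card + j ∧
      (∀ b, (freePoints c g b).card = (freePoints c f b).card + j) ∧
      meanIndepNum lab g ≤ meanIndepNum lab f + j := by
  induction j with
  | zero => exact ⟨f, hf, by simp⟩
  | succ j ih =>
    obtain ⟨g, hg, hgc, hgf, hle⟩ := ih (by omega)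
    obtain ⟨g', x, z, hg', -, -, hxz, hx, hz, hgg', hgc', hgf'⟩ :=
      exists_delete_crossPoint c hg (Finset.card_pos.1 (by omega))
    refine ⟨g', hg', by omega, fun b => by rw [hgf', hgf, add_assoc], ?_⟩
    have := meanIndepNum_le_mul_swap_add_one hxz hx hz lab
    rw [← hgg'] at this
    push_cast
    linarith

theorem le_meanIndepNum_add_card_crossPoints {lab : Ω → X → V} {c : X → Bool} {L : ℝ}
    (hL : ∀ g : Equiv.Perm X, Function.Involutive g → crossPoints c g = ∅ →
      L ≤ meanIndepNum lab g) {f : Equiv.Perm X} (hf : Function.Involutive f) :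
    L ≤ meanIndepNum lab f + (crossPoints c f).card := by
  obtain ⟨g, hg, hgc, -, hle⟩ := exists_delete_crossPoints lab c hf _ le_rfl
  exact (hL g hg (Finset.card_eq_zero.1 (by omega))).trans hle

/-- Replacing bichromatic edges by monochromatic edges of a random colour, with the imbalance of
unmatched points controlled by a quadratic potential. -/
theorem Exchangeable.le_meanIndepNum_add_potential {lab : Ω → X → V} {c : X → Bool}
    (h : Exchangeable lab c) {L : ℝ}
    (hL : ∀ g : Equiv.Perm X, Function.Involutive g → crossPoints c g = ∅ →
      L ≤ meanIndepNum lab g) {s K : ℕ} (hs : 1 ≤ s) (k : ℕ) (hk : k ≤ K) {f : Equiv.Perm X}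
    (hf : Function.Involutive f) (hfk : (crossPoints c f).card = k)
    (hfs : (freePoints c f true).card + (freePoints c f false).card = 2 * s) :
    L ≤ meanIndepNum lab f + 2 / s * k +
      4 * K / s ^ 2 * (((freePoints c f true).card - s : ℝ) ^ 2 + k) := by
  have hs' : (0 : ℝ) < s := by exact_mod_cast hs
  induction k generalizing f with
  | zero =>
    have h1 := hL f hf (Finset.card_eq_zero.1 hfk)
    have h2 : 0 ≤ 4 * (K : ℝ) / s ^ 2 * (((freePoints c f true).card - s : ℝ) ^ 2) := by positivity
    simp only [Nat.cast_zero, mul_zero, add_zero]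
    linarith
  | succ k ih =>
    have hfs' : ((freePoints c f true).card : ℝ) + (freePoints c f false).card = 2 * s := by
      exact_mod_cast hfs
    by_cases hbad : 2 * (freePoints c f true).card < s ∨ 2 * (freePoints c f false).card < s
    · have h1 := le_meanIndepNum_add_card_crossPoints hL hf
      rw [hfk] at h1
      have h2 : (s : ℝ) ^ 2 ≤ 4 * ((freePoints c f true).card - s : ℝ) ^ 2 := by
        rcases hbad with hb | hb
        · have hb' : 2 * ((freePoints c f true).card : ℝ) < s := by exact_mod_cast hb
          nlinarith
        · have hb' : 2 * ((freePoints c f false).card : ℝ) < s := by exact_mod_cast hb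
          nlinarith
      have h3 : ((k + 1 : ℕ) : ℝ) ≤ K := by exact_mod_cast hk
      have h4 : (K : ℝ) ≤ 4 * K / s ^ 2 * ((freePoints c f true).card - s : ℝ) ^ 2 := by
        rw [div_mul_eq_mul_div, le_div_iff₀ (by positivity)]
        nlinarith [(Nat.cast_nonneg K : (0 : ℝ) ≤ K)]
      have h5 : 0 ≤ 2 / (s : ℝ) * (k + 1 : ℕ) := by positivity
      have h6 : 0 ≤ 4 * (K : ℝ) / s ^ 2 * (k + 1 : ℕ) := by positivity
      rw [mul_add]
      linarith
    · push Not at hbad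
      obtain ⟨g, x, z, hg, hcx, hcz, hxz, hx, hz, hfg, hgc, hgf⟩ :=
        exists_delete_crossPoint c hf (Finset.card_pos.1 (by omega))
      obtain ⟨y, hy, hyx⟩ := Finset.exists_mem_ne (s := freePoints c g true)
        (by rw [hgf]; omega) x
      obtain ⟨w, hw, hwz⟩ := Finset.exists_mem_ne (s := freePoints c g false)
        (by rw [hgf]; omega) z
      simp only [freePoints, Finset.mem_filter, Finset.mem_univ, true_and] at hy hw
      have hstep := h.meanIndepNum_add_le hx hy.2 hz hw.2 hyx.symm hwz.symm hcx hy.1 hcz hw.1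
      rw [← hfg] at hstep
      change _ ≤ _ + 1 / ((freePoints c g true).card : ℝ) + 1 / ((freePoints c g false).card : ℝ)
        at hstep
      have c₁ := card_freePoints_mul_swap c hyx.symm hx hy.2
      have c₂ := card_freePoints_mul_swap c hwz.symm hz hw.2
      have c₁t := c₁ true
      have c₁f := c₁ false
      have c₂t := c₂ true
      have c₂f := c₂ false
      simp only [hgf, hcx, hcz, hy.1, hw.1, if_true, Bool.false_eq_true, Bool.true_eq_false,
        if_false] at c₁t c₁f c₂t c₂f
      have ih₁ := ih (by omega) (involutive_mul_swap hg hx hy.2)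
        (by rw [crossPoints_mul_swap_of_eq c hx hy.2 (hcx.trans hy.1.symm)]; omega) (by omega)
      have ih₂ := ih (by omega) (involutive_mul_swap hg hz hw.2)
        (by rw [crossPoints_mul_swap_of_eq c hz hw.2 (hcz.trans hw.1.symm)]; omega) (by omega)
      have e₁ : ((freePoints c ⇑(g * Equiv.swap x y) true).card : ℝ) =
          (freePoints c f true).card - 1 := by
        rw [eq_sub_iff_add_eq]; norm_cast; omega
      have e₂ : ((freePoints c ⇑(g * Equiv.swap z w) true).card : ℝ) =
          (freePoints c f true).card + 1 := by
        norm_cast; omega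
      rw [e₁] at ih₁
      rw [e₂] at ih₂
      have herr : ∀ b, (s : ℕ) ≤ 2 * (freePoints c f b).card →
          1 / ((freePoints c g b).card : ℝ) ≤ 2 / s := by
        intro b hb
        have hb' : (s : ℝ) ≤ 2 * (freePoints c f b).card := by exact_mod_cast hb
        rw [hgf, Nat.cast_add_one, div_le_div_iff₀ (Nat.cast_add_one_pos _) hs']
        linarith
      have hT := herr true hbad.1
      have hF := herr false hbad.2
      push_cast
      have hexp : 2 * (2 / (s : ℝ) * (k + 1) + 4 * K / s ^ 2 *
            (((freePoints c f true).card - s : ℝ) ^ 2 + (k + 1))) =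
          (2 / (s : ℝ) * k + 4 * K / s ^ 2 *
            (((freePoints c f true).card - 1 - s : ℝ) ^ 2 + k)) +
          (2 / (s : ℝ) * k + 4 * K / s ^ 2 *
            (((freePoints c f true).card + 1 - s : ℝ) ^ 2 + k)) + 2 / s + 2 / s := by
        ring
      linarith

/-- The interpolation bound for perfect matchings. -/
theorem Exchangeable.le_meanIndepNum_add {lab : Ω → X → V} {c : X → Bool}
    (h : Exchangeable lab c) {L : ℝ}
    (hL : ∀ g : Equiv.Perm X, Function.Involutive g → crossPoints c g = ∅ →
      L ≤ meanIndepNum lab g) {s K : ℕ} (hs : 1 ≤ s) {f : Equiv.Perm X}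
    (hf : Function.Involutive f) (hfix : ∀ x, f x ≠ x) (hK : (crossPoints c f).card ≤ K) :
    L ≤ meanIndepNum lab f + (s + 2 * K / s + 4 * K ^ 2 / s ^ 2) := by
  rcases le_total s (crossPoints c f).card with hle | hle
  · obtain ⟨g, hg, hgc, hgf, hgm⟩ := exists_delete_crossPoints lab c hf s hle
    have hfree : ∀ b, (freePoints c g b).card = s := by
      intro b
      have : freePoints c f b = ∅ := by simp [freePoints, hfix]
      rw [hgf, this, Finset.card_empty, zero_add]
    have key := h.le_meanIndepNum_add_potential hL hs _ (K := K) (by omega) hg rfl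
      (by rw [hfree, hfree]; ring)
    rw [hfree, sub_self] at key
    have hkK : ((crossPoints c g).card : ℝ) ≤ K := by
      exact_mod_cast (show (crossPoints c g).card ≤ K by omega)
    have h1 : 2 / (s : ℝ) * (crossPoints c g).card ≤ 2 / s * K := by gcongr
    have h2 : 4 * (K : ℝ) / s ^ 2 * (0 ^ 2 + (crossPoints c g).card) ≤ 4 * K / s ^ 2 * K := by
      rw [zero_pow two_ne_zero, zero_add]
      gcongr
    have h3 : 2 / (s : ℝ) * K + 4 * K / s ^ 2 * K = 2 * K / s + 4 * K ^ 2 / s ^ 2 := by ring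
    linarith
  · have h1 := le_meanIndepNum_add_card_crossPoints hL hf
    have h2 : ((crossPoints c f).card : ℝ) ≤ s := by exact_mod_cast hle
    have h3 : 0 ≤ 2 * (K : ℝ) / s + 4 * K ^ 2 / s ^ 2 := by positivity
    linarith

end Interpolation

section Concentration

open scoped BigOperators

theorem expect_prod_univ {α β : Type*} [Fintype α] [Fintype β] (f : α × β → ℝ) :
    𝔼 x, f x = 𝔼 a, 𝔼 b, f (a, b) := by
  rw [← Finset.expect_product, Finset.univ_product_univ]

/-- The variance of a function of a uniform permutation that varies by at most `c` under
transpositions is at most `c ^ 2` times the number of permuted points. -/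
theorem expect_sq_perm_le (c : ℝ) (α : Type*) [Fintype α] : ∀ [DecidableEq α]
    (g : Equiv.Perm α → ℝ) (_ : ∀ π a b, |g (π * Equiv.swap a b) - g π| ≤ c),
    𝔼 π, g π ^ 2 ≤ (𝔼 π, g π) ^ 2 + c ^ 2 * Fintype.card α := by
  refine Fintype.induction_empty_option (P := fun α _ => ∀ [DecidableEq α]
    (g : Equiv.Perm α → ℝ) (_ : ∀ π a b, |g (π * Equiv.swap a b) - g π| ≤ c),
    𝔼 π, g π ^ 2 ≤ (𝔼 π, g π) ^ 2 + c ^ 2 * Fintype.card α) ?_ ?_ ?_ α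
  · intro α β _ e ih _ g hg
    classical
    let _ := Fintype.ofEquiv β e.symm
    have hswap : ∀ (π : Equiv.Perm α) a b, e.permCongr (π * Equiv.swap a b) =
        e.permCongr π * Equiv.swap (e a) (e b) := by
      intro π a b
      ext t
      simp only [Equiv.permCongr_apply, Equiv.Perm.mul_apply, Equiv.swap_apply_def,
        Equiv.symm_apply_eq]
      split_ifs <;> simp
    have key := ih (fun π => g (e.permCongr π)) fun π a b => by rw [hswap]; exact hg _ _ _
    rw [Fintype.expect_equiv e.permCongr _ (fun π => g π ^ 2) fun _ => rfl,
      Fintype.expect_equiv e.permCongr _ g fun _ => rfl] at key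
    rwa [← Fintype.card_congr e]
  · intro _ g _
    simp [Finset.univ_unique]
  · intro α _ ih _ g hg
    classical
    have hfac : ∀ φ : ℝ → ℝ, 𝔼 π, φ (g π) =
        𝔼 i : Option α, 𝔼 σ : Equiv.Perm α, φ (g (Equiv.swap none i * Equiv.optionCongr σ)) := by
      intro φ
      rw [← expect_prod_univ (fun p : Option α × Equiv.Perm α =>
        φ (g (Equiv.swap none p.1 * Equiv.optionCongr p.2)))]
      refine (Fintype.expect_equiv Equiv.Perm.decomposeOption.symm _ _ fun p => ?_).symm
      rw [Equiv.Perm.decomposeOption_symm_apply]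
      congr!
    set m : Option α → ℝ := fun i => 𝔼 σ : Equiv.Perm α, g (Equiv.swap none i * Equiv.optionCongr σ)
      with hm
    have h1 : ∀ i, 𝔼 σ : Equiv.Perm α, g (Equiv.swap none i * Equiv.optionCongr σ) ^ 2 ≤
        m i ^ 2 + c ^ 2 * Fintype.card α := by
      intro i
      refine ih _ fun σ a b => ?_
      have : Equiv.optionCongr (σ * Equiv.swap a b) =
          Equiv.optionCongr σ * Equiv.swap (some a) (some b) := by
        have hs : Equiv.swap (some a) (some b) = Equiv.optionCongr (Equiv.swap a b) := by
          rw [Equiv.optionCongr_swap]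
          congr!
        rw [hs]
        ext1 t
        cases t <;> rfl
      rw [this, ← mul_assoc]
      exact hg _ _ _
    have h2 : ∀ i, (m i - m none) ^ 2 ≤ c ^ 2 := by
      intro i
      apply sq_le_sq'
      all_goals
        have : |m i - m none| ≤ c := by
          simp only [hm, ← Finset.expect_sub_distrib]
          refine (Finset.abs_expect_le _ _).trans ?_
          refine Finset.expect_le Finset.univ_nonempty fun σ _ => ?_
          rw [Equiv.swap_self, Equiv.swap_mul_eq_mul_swap]
          exact hg _ _ _
        have := abs_le.1 this
        linarith
    have h3 : 𝔼 i, (m i - m none) ^ 2 ≤ c ^ 2 :=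
      Finset.expect_le Finset.univ_nonempty fun i _ => h2 i
    have h4 : 𝔼 i, (m i - m none) ^ 2 =
        𝔼 i, m i ^ 2 - 2 * m none * 𝔼 i, m i + m none ^ 2 := by
      rw [← Fintype.expect_const (ι := Option α) (m none ^ 2), Finset.mul_expect,
        ← Finset.expect_sub_distrib, ← Finset.expect_add_distrib]
      exact Finset.expect_congr rfl fun i _ => by ring
    have h5 : 𝔼 π, g π = 𝔼 i, m i := hfac id
    have h6 : 𝔼 π, g π ^ 2 ≤ 𝔼 i, m i ^ 2 + c ^ 2 * Fintype.card α := by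
      rw [hfac (· ^ 2), ← Fintype.expect_const (ι := Option α) (c ^ 2 * (Fintype.card α : ℝ)),
        ← Finset.expect_add_distrib]
      exact Finset.expect_le_expect fun i _ => h1 i
    rw [h5, Fintype.card_option]
    push_cast
    nlinarith [sq_nonneg (𝔼 i, m i - m none)]

/-- Chebyshev's inequality for functions of a uniform permutation. -/
theorem expect_perm_indicator_le {α : Type*} [Fintype α] [DecidableEq α] {c t : ℝ} (ht : 0 < t)
    (g : Equiv.Perm α → ℝ) (hg : ∀ π a b, |g (π * Equiv.swap a b) - g π| ≤ c) :
    (𝔼 π, if t < |g π - 𝔼 σ, g σ| then (1 : ℝ) else 0) ≤ c ^ 2 * Fintype.card α / t ^ 2 := by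
  set m := 𝔼 σ, g σ
  have h1 : 𝔼 π, (g π - m) ^ 2 ≤ c ^ 2 * Fintype.card α := by
    have : 𝔼 π, (g π - m) ^ 2 = 𝔼 π, g π ^ 2 - 2 * m * m + m ^ 2 := by
      conv_rhs => rw [← Fintype.expect_const (ι := Equiv.Perm α) (m ^ 2)]
      rw [show 2 * m * m = 2 * m * 𝔼 σ, g σ from rfl, Finset.mul_expect,
        ← Finset.expect_sub_distrib, ← Finset.expect_add_distrib]
      exact Finset.expect_congr rfl fun i _ => by ring
    have := expect_sq_perm_le c α g hg
    linarith
  rw [le_div_iff₀ (by positivity), Finset.expect_mul]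
  refine le_trans (Finset.expect_le_expect fun π _ => ?_) h1
  split_ifs with h
  · rw [one_mul, ← sq_abs (g π - m)]
    gcongr
  · rw [zero_mul]; positivity

end Concentration

section PerfectMatchings

open scoped BigOperators

theorem expect_eq_expect_smul {G M : Type*} [Group G] [Fintype G] [Fintype M] [MulAction G M]
    (m₀ : M) (h : ∀ m : M, ∃ g : G, g • m₀ = m) (φ : M → ℝ) :
    𝔼 m, φ m = 𝔼 g : G, φ (g • m₀) := by
  have : Nonempty M := ⟨m₀⟩
  have h₁ : ∀ g : G, 𝔼 m, φ (g • m) = 𝔼 m, φ m := fun g =>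
    Fintype.expect_equiv (MulAction.toPerm g) _ _ fun m => rfl
  have h₂ : ∀ m, 𝔼 g : G, φ (g • m) = 𝔼 g : G, φ (g • m₀) := by
    intro m
    obtain ⟨k, rfl⟩ := h m
    exact Fintype.expect_equiv (Equiv.mulRight k) _ _ fun g => by
      rw [Equiv.coe_mulRight, mul_smul]
  calc 𝔼 m, φ m = 𝔼 g : G, 𝔼 m, φ (g • m) := by simp_rw [h₁, Fintype.expect_const]
    _ = 𝔼 m, 𝔼 g : G, φ (g • m) := Finset.expect_comm _ _ _
    _ = _ := by simp_rw [h₂, Fintype.expect_const]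

theorem isConj_of_involutive {X : Type*} [Fintype X] [DecidableEq X] {f g : Equiv.Perm X}
    (hf : Function.Involutive f) (hg : Function.Involutive g) (hf' : ∀ x, f x ≠ x)
    (hg' : ∀ x, g x ≠ x) : IsConj f g := by
  have key : ∀ f : Equiv.Perm X, Function.Involutive f → (∀ x, f x ≠ x) →
      f.cycleType = Multiset.replicate (Fintype.card X / 2) 2 := by
    intro f hf hf'
    have h₁ : ∀ c ∈ f.cycleType, c = 2 :=
      Equiv.Perm.pow_prime_eq_one_iff.1 (Equiv.ext fun x => by simp [sq, hf x])
    have h₂ := Multiset.eq_replicate_card.2 h₁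
    have h₃ := f.sum_cycleType
    have h₄ : f.support = Finset.univ := by ext x; simp [hf' x]
    rw [h₂, Multiset.sum_replicate, h₄, Finset.card_univ, smul_eq_mul] at h₃
    rw [h₂, ← h₃]
    simp
  rw [Equiv.Perm.isConj_iff_cycleType_eq, key f hf hf', key g hg hg']

/-- Every partial matching of a set of even cardinality extends to a perfect matching. -/
theorem exists_perfect_extension {X : Type*} [Fintype X] [DecidableEq X]
    (hX : Even (Fintype.card X)) (g : Equiv.Perm X) (hg : Function.Involutive g) :
    ∃ f : Equiv.Perm X, Function.Involutive f ∧ (∀ x, f x ≠ x) ∧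
      ∀ {V : Type} [Fintype V] (w : X → V), indepNum w f ≤ indepNum w g := by
  induction hk : (freePoints (fun _ => true) g true).card using Nat.strong_induction_on
    generalizing g with
  | _ k ih =>
    by_cases hfix : ∀ x, g x ≠ x
    · exact ⟨g, hg, hfix, fun w => le_rfl⟩
    push Not at hfix
    obtain ⟨x, hx⟩ := hfix
    have hpar : Even (freePoints (fun _ => true) g true).card := by
      have h := Equiv.Perm.card_fixedPoints_modEq (f := (⇑g : Function.End X)) (p := 2) (n := 1)
        (funext fun t => hg t)
      rw [Nat.even_iff, ← Nat.even_iff.1 hX]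
      refine Eq.trans ?_ h.symm
      rw [Fintype.card_subtype]
      congr 2
      ext t
      simp [freePoints, Function.IsFixedPt]
    have hpos : 0 < (freePoints (fun _ => true) g true).card :=
      Finset.card_pos.2 ⟨x, by simp [freePoints, hx]⟩
    obtain ⟨y, hy, hyx⟩ := Finset.exists_mem_ne (s := freePoints (fun _ => true) g true)
      (by obtain ⟨j, hj⟩ := hpar; omega) x
    simp only [freePoints, Finset.mem_filter, Finset.mem_univ, true_and] at hy
    have hc := card_freePoints_mul_swap (fun _ => true) hyx.symm hx hy true
    obtain ⟨f, hf, hf', hle⟩ := ih _ (by simp only [if_true] at hc; omega) _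
      (involutive_mul_swap hg hx hy) rfl
    exact ⟨f, hf, hf', fun w => (hle w).trans (indepNum_mul_swap_le hyx.symm hx hy w)⟩

variable {N r : ℕ}

/-- Permutations of the half-edges act on perfect matchings by conjugation. -/
noncomputable instance : MulAction (Equiv.Perm (Fin N × Fin r)) (Matching N r) where
  smul π f := ⟨fun h => π (f.1 (π.symm h)), fun h => by simp [f.2.1], fun h => by
    simpa [← Equiv.eq_symm_apply] using f.2.2 (π.symm h)⟩
  one_smul f := rfl
  mul_smul π σ f := rfl

theorem maxIndepReg_eq_indepNum (f : Matching N r) :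
    maxIndepReg f = indepNum Prod.fst f.1 := by
  unfold maxIndepReg indepNum IsIndep
  congr! 3 with S
  simp [f.2.2 _]

/-- The perfect matching given by a fixed-point-free involution. -/
def Matching.ofPerm (f : Equiv.Perm (Fin N × Fin r)) (hf : Function.Involutive f)
    (hf' : ∀ x, f x ≠ x) : Matching N r := ⟨f, hf, hf'⟩

theorem Matching.expect_eq (f : Equiv.Perm (Fin N × Fin r)) (hf : Function.Involutive f)
    (hf' : ∀ x, f x ≠ x) (φ : ℕ → ℝ) :
    𝔼 M : Matching N r, φ (maxIndepReg M) =
      𝔼 π : Equiv.Perm (Fin N × Fin r), φ (indepNum (Prod.fst ∘ π) f) := by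
  rw [expect_eq_expect_smul (G := Equiv.Perm (Fin N × Fin r)) (Matching.ofPerm f hf hf')]
  · refine Finset.expect_congr rfl fun π _ => ?_
    rw [maxIndepReg_eq_indepNum, indepNum_comp_equiv]
    rfl
  · intro M
    have hM : Function.Involutive M.1 := M.2.1
    obtain ⟨π, hπ⟩ := isConj_iff.1
      (isConj_of_involutive hf (g := hM.toPerm) hM hf' M.2.2)
    refine ⟨π, Subtype.ext (funext fun h => ?_)⟩
    exact congrArg (fun σ : Equiv.Perm _ => σ h) hπ

theorem exists_perfect (h : Even (N * r)) :
    ∃ f : Equiv.Perm (Fin N × Fin r), Function.Involutive f ∧ ∀ x, f x ≠ x := by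
  obtain ⟨f, hf, hf', -⟩ := exists_perfect_extension (X := Fin N × Fin r) (by simpa using h) 1
    fun _ => rfl
  exact ⟨f, hf, hf'⟩

/-- The expected independence number of the random regular multigraph. -/
noncomputable def meanMaxIndep (N r : ℕ) : ℝ := 𝔼 M : Matching N r, (maxIndepReg M : ℝ)

theorem meanMaxIndep_eq (f : Equiv.Perm (Fin N × Fin r)) (hf : Function.Involutive f)
    (hf' : ∀ x, f x ≠ x) : meanMaxIndep N r =
      meanIndepNum (fun π : Equiv.Perm (Fin N × Fin r) => Prod.fst ∘ π) f :=
  Matching.expect_eq f hf hf' Nat.cast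

/-- Chebyshev's inequality for the independence number of the random regular multigraph. -/
theorem probReg_lt_abs_sub_meanMaxIndep_le (h : Even (N * r)) {t : ℝ} (ht : 0 < t) :
    probReg N r (fun f => t < |(maxIndepReg f : ℝ) - meanMaxIndep N r|) ≤
      4 * (N * r) / t ^ 2 := by
  obtain ⟨f, hf, hf'⟩ := exists_perfect h
  have key := expect_perm_indicator_le (c := 2) ht
    (fun π : Equiv.Perm (Fin N × Fin r) => (indepNum (Prod.fst ∘ π) f : ℝ)) fun π a b => by
      have h₁ := indepNum_le_comp_swap_add_two (Prod.fst ∘ π) f a b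
      have h₂ := indepNum_le_comp_swap_add_two ((Prod.fst ∘ π) ∘ Equiv.swap a b) f a b
      rw [Function.comp_assoc _ (Equiv.swap a b), ← Equiv.coe_trans, Equiv.swap_swap,
        Equiv.coe_refl, Function.comp_id] at h₂
      rw [Equiv.Perm.coe_mul, ← Function.comp_assoc, abs_le]
      constructor
      · rw [neg_le_sub_iff_le_add]; exact_mod_cast h₁
      · rw [sub_le_iff_le_add']; exact_mod_cast (by omega)
  have h₁ := Matching.expect_eq f hf hf'
    (fun n => if t < |(n : ℝ) - meanMaxIndep N r| then (1 : ℝ) else 0)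
  rw [meanMaxIndep_eq f hf hf'] at h₁ ⊢
  have h₂ : probReg N r (fun M => t < |(maxIndepReg M : ℝ) - meanIndepNum
      (fun π : Equiv.Perm (Fin N × Fin r) => Prod.fst ∘ π) f|) =
      𝔼 M : Matching N r, if t < |(maxIndepReg M : ℝ) - meanIndepNum
        (fun π : Equiv.Perm (Fin N × Fin r) => Prod.fst ∘ π) f| then (1 : ℝ) else 0 := by
    rw [probReg, Finset.card_filter, Nat.cast_sum, ← Fintype.expect_eq_sum_div_card]
    simp_rw [Nat.cast_ite, Nat.cast_one, Nat.cast_zero]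
  rw [h₂, h₁]
  refine key.trans_eq ?_
  simp
  norm_num

end PerfectMatchings

section Superadditivity

open scoped BigOperators

theorem involutive_permCongr {X Y : Type*} (e : X ≃ Y) {f : Equiv.Perm X}
    (hf : Function.Involutive f) : Function.Involutive (e.permCongr f) := fun y => by
  rw [Equiv.permCongr_apply, Equiv.permCongr_apply, e.symm_apply_apply, hf, e.apply_symm_apply]

theorem permCongr_apply_ne {X Y : Type*} (e : X ≃ Y) {f : Equiv.Perm X} (hf : ∀ x, f x ≠ x)
    (y : Y) : e.permCongr f y ≠ y := by
  rw [Equiv.permCongr_apply, Ne, ← Equiv.eq_symm_apply]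
  exact hf _

variable {X₁ X₂ V₁ V₂ : Type*}

/-- Independent uniform relabellings of the points of the two summands. -/
def sumLabel (w₁ : X₁ → V₁) (w₂ : X₂ → V₂) (h : Equiv.Perm X₁ × Equiv.Perm X₂) :
    X₁ ⊕ X₂ → V₁ ⊕ V₂ :=
  Sum.map (w₁ ∘ h.1) (w₂ ∘ h.2)

theorem exchangeable_sumLabel [DecidableEq X₁] [DecidableEq X₂] (w₁ : X₁ → V₁) (w₂ : X₂ → V₂) :
    Exchangeable (sumLabel w₁ w₂) Sum.isLeft := by
  rintro (x | x) (y | y) hxy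
  · refine ⟨Equiv.mulRight (Equiv.swap x y, 1), fun h => ?_⟩
    rw [← Equiv.Perm.sumCongr_swap_one]
    ext (t | t) <;> rfl
  · simp at hxy
  · simp at hxy
  · refine ⟨Equiv.mulRight (1, Equiv.swap x y), fun h => ?_⟩
    rw [← Equiv.Perm.sumCongr_one_swap]
    ext (t | t) <;> rfl

variable [Fintype X₁] [Fintype X₂]

theorem exists_sumCongr_of_crossPoints_eq_empty {g : Equiv.Perm (X₁ ⊕ X₂)}
    (hg : Function.Involutive g) (hc : crossPoints Sum.isLeft g = ∅) :
    ∃ (g₁ : Equiv.Perm X₁) (g₂ : Equiv.Perm X₂), Function.Involutive g₁ ∧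
      Function.Involutive g₂ ∧ g = Equiv.Perm.sumCongr g₁ g₂ := by
  have hmaps : Set.MapsTo g (Set.range Sum.inl) (Set.range Sum.inl) := by
    rintro _ ⟨x, rfl⟩
    have h : Sum.inl x ∉ crossPoints Sum.isLeft g := by simp [hc]
    rcases hx : g (Sum.inl x) with y | y
    · exact ⟨y, rfl⟩
    · simp [crossPoints, hx] at h
  obtain ⟨⟨g₁, g₂⟩, rfl⟩ := Equiv.Perm.mem_sumCongrHom_range_of_perm_mapsTo_inl hmaps
  exact ⟨g₁, g₂, fun x => Sum.inl_injective (hg (Sum.inl x)),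
    fun x => Sum.inr_injective (hg (Sum.inr x)), rfl⟩

theorem card_crossPoints_isLeft_le (f : X₁ ⊕ X₂ → X₁ ⊕ X₂) :
    (crossPoints Sum.isLeft f).card ≤ Fintype.card X₁ := by
  rw [← Finset.card_univ, ← Finset.card_map (s := Finset.univ) Function.Embedding.inl]
  refine Finset.card_le_card fun x hx => ?_
  rcases x with x | x
  · simp
  · simp [crossPoints] at hx

variable [DecidableEq X₁] [DecidableEq X₂] [Fintype V₁] [Fintype V₂]

theorem meanIndepNum_add_le_sumLabel (w₁ : X₁ → V₁) (w₂ : X₂ → V₂) (g₁ : Equiv.Perm X₁)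
    (g₂ : Equiv.Perm X₂) :
    meanIndepNum (fun π : Equiv.Perm X₁ => w₁ ∘ π) g₁ +
        meanIndepNum (fun π : Equiv.Perm X₂ => w₂ ∘ π) g₂ ≤
      meanIndepNum (sumLabel w₁ w₂) (Equiv.Perm.sumCongr g₁ g₂) := by
  calc _ = 𝔼 h : Equiv.Perm X₁ × Equiv.Perm X₂,
        ((indepNum (w₁ ∘ h.1) g₁ : ℝ) + indepNum (w₂ ∘ h.2) g₂) := by
        rw [expect_prod_univ]
        simp only [Finset.expect_add_distrib, Fintype.expect_const]
        rfl
    _ ≤ _ := Finset.expect_le_expect fun h _ => by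
        exact_mod_cast indepNum_add_le_sum (w₁ ∘ h.1) (w₂ ∘ h.2) g₁ g₂

theorem meanIndepNum_perm_eq_expect_sumLabel (w₁ : X₁ → V₁) (w₂ : X₂ → V₂)
    (f : Equiv.Perm (X₁ ⊕ X₂)) :
    meanIndepNum (fun π : Equiv.Perm (X₁ ⊕ X₂) => Sum.map w₁ w₂ ∘ π) f =
      𝔼 π : Equiv.Perm (X₁ ⊕ X₂), meanIndepNum (sumLabel w₁ w₂) (π.permCongr f) := by
  have key : ∀ h : Equiv.Perm X₁ × Equiv.Perm X₂,
      meanIndepNum (fun π : Equiv.Perm (X₁ ⊕ X₂) => Sum.map w₁ w₂ ∘ π) f =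
        𝔼 π : Equiv.Perm (X₁ ⊕ X₂), (indepNum (sumLabel w₁ w₂ h) (π.permCongr f) : ℝ) := by
    intro h
    refine (Fintype.expect_equiv (Equiv.mulLeft (Equiv.Perm.sumCongr h.1 h.2)) _ _
      fun π => ?_).symm
    rw [← indepNum_comp_equiv]
    congr 2
    ext t
    simp only [Function.comp_apply, Equiv.coe_mulLeft, Equiv.Perm.mul_apply, sumLabel]
    rcases π t with x | x <;> rfl
  simp only [meanIndepNum] at key ⊢
  rw [Finset.expect_comm, ← Finset.expect_congr rfl fun h _ => key h, Fintype.expect_const]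

theorem meanMaxIndep_add_eq {n m r : ℕ} {f : Equiv.Perm (Fin (n + m) × Fin r)}
    (hf : Function.Involutive f) (hf' : ∀ x, f x ≠ x)
    (e : (Fin n × Fin r) ⊕ (Fin m × Fin r) ≃ Fin (n + m) × Fin r)
    (he : Prod.fst ∘ e = finSumFinEquiv ∘ Sum.map Prod.fst Prod.fst) :
    meanMaxIndep (n + m) r =
      meanIndepNum (fun π : Equiv.Perm ((Fin n × Fin r) ⊕ (Fin m × Fin r)) =>
        Sum.map Prod.fst Prod.fst ∘ π) (e.symm.permCongr f) := by
  rw [meanMaxIndep_eq f hf hf']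
  refine (Fintype.expect_equiv e.permCongr _ _ fun π => ?_).symm
  rw [← indepNum_comp_equiv, ← indepNum_equiv_comp finSumFinEquiv]
  congr 2
  ext t
  have := congrFun he (π (e.symm t))
  simp only [Function.comp_apply] at this
  simp only [Function.comp_apply, Equiv.permCongr_apply, this]

theorem meanMaxIndep_add_le {n m r : ℕ} (hn : Even (n * r)) (hm : Even (m * r)) {s : ℕ}
    (hs : 1 ≤ s) :
    meanMaxIndep n r + meanMaxIndep m r ≤
      meanMaxIndep (n + m) r +
        (s + 2 * (n * r : ℕ) / s + 4 * (n * r : ℕ) ^ 2 / s ^ 2) := by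
  obtain ⟨f, hf, hf'⟩ := exists_perfect (N := n + m) (r := r) (by rw [add_mul]; exact hn.add hm)
  have he := meanMaxIndep_add_eq hf hf' ((Equiv.sumProdDistrib _ _ _).symm.trans
    (finSumFinEquiv.prodCongr (Equiv.refl _))) (by ext (x | x) <;> rfl)
  rw [he, meanIndepNum_perm_eq_expect_sumLabel, ← sub_le_iff_le_add]
  refine Finset.le_expect Finset.univ_nonempty fun π _ => sub_le_iff_le_add.2 ?_
  refine (exchangeable_sumLabel _ _).le_meanIndepNum_add ?_ hs ?_ ?_
    ((card_crossPoints_isLeft_le _).trans_eq (by simp))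
  · intro g hg hc
    obtain ⟨g₁, g₂, hg₁, hg₂, rfl⟩ := exists_sumCongr_of_crossPoints_eq_empty hg hc
    refine le_trans ?_ (meanIndepNum_add_le_sumLabel _ _ _ _)
    have mean_le : ∀ {N : ℕ}, Even (N * r) → ∀ g : Equiv.Perm (Fin N × Fin r),
        Function.Involutive g →
          meanMaxIndep N r ≤ meanIndepNum (fun π : Equiv.Perm _ => Prod.fst ∘ π) g := by
      intro N hN g hg
      obtain ⟨k, hk, hk', hle⟩ := exists_perfect_extension (by simpa using hN) g hg
      rw [meanMaxIndep_eq k hk hk']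
      exact Finset.expect_le_expect fun π _ => Nat.cast_le.2 (hle _)
    exact add_le_add (mean_le hn g₁ hg₁) (mean_le hm g₂ hg₂)
  · exact involutive_permCongr _ (involutive_permCongr _ hf)
  · exact permCongr_apply_ne _ (permCongr_apply_ne _ hf')

theorem meanMaxIndep_nonneg (N r : ℕ) : 0 ≤ meanMaxIndep N r :=
  Finset.expect_nonneg fun _ _ => Nat.cast_nonneg _

theorem meanMaxIndep_le {N r : ℕ} (h : Even (N * r)) : meanMaxIndep N r ≤ N := by
  obtain ⟨f, hf, hf'⟩ := exists_perfect h
  rw [meanMaxIndep_eq f hf hf']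
  refine Finset.expect_le Finset.univ_nonempty fun π _ => ?_
  exact Nat.cast_le.2 ((indepNum_le_card _ _).trans_eq (Fintype.card_fin N))

/-- Superadditivity of the mean up to an error that is sublinear in the smaller part. -/
theorem exists_meanMaxIndep_add_le (r : ℕ) {δ : ℝ} (hδ : 0 < δ) :
    ∃ C : ℝ, ∀ n m : ℕ, Even (n * r) → Even (m * r) →
      meanMaxIndep n r + meanMaxIndep m r ≤ meanMaxIndep (n + m) r + (δ * n + C) := by
  refine ⟨1 + 2 * r / δ + 4 * r ^ 2 / δ ^ 2, fun n m hn hm => ?_⟩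
  rcases Nat.eq_zero_or_pos n with rfl | hpos
  · have := meanMaxIndep_le hn
    have h : (0 : ℝ) ≤ 1 + 2 * r / δ + 4 * r ^ 2 / δ ^ 2 := by positivity
    simp only [Nat.cast_zero, zero_add, mul_zero] at this ⊢
    linarith
  · have hn0 : (0 : ℝ) < n := by exact_mod_cast hpos
    have hs0 : 0 < δ * n := by positivity
    refine (meanMaxIndep_add_le hn hm (s := ⌈δ * n⌉₊) (Nat.ceil_pos.2 hs0)).trans ?_
    have h₁ : δ * n ≤ ⌈δ * n⌉₊ := Nat.le_ceil _
    have h₂ : (⌈δ * n⌉₊ : ℝ) < δ * n + 1 := Nat.ceil_lt_add_one hs0.le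
    have h₃ : 2 * ((n * r : ℕ) : ℝ) / ⌈δ * n⌉₊ ≤ 2 * r / δ := by
      calc _ ≤ 2 * ((n * r : ℕ) : ℝ) / (δ * n) := by gcongr
        _ = _ := by push_cast; field_simp
    have h₄ : 4 * ((n * r : ℕ) : ℝ) ^ 2 / (⌈δ * n⌉₊ : ℝ) ^ 2 ≤ 4 * r ^ 2 / δ ^ 2 := by
      calc _ ≤ 4 * ((n * r : ℕ) : ℝ) ^ 2 / (δ * n) ^ 2 := by gcongr
        _ = _ := by push_cast; field_simp
    linarith

end Superadditivity

section ScalingLimit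

open scoped Topology

/-- A version of Fekete's lemma along a set closed under remainders, for nonnegative sequences
that are superadditive up to an error that is sublinear in the smaller part. -/
theorem exists_tendsto_div_of_almost_superadditive {A : Set ℕ} {F : ℕ → ℝ}
    (hA : (atTop ⊓ 𝓟 A).NeBot) (hmod : ∀ n ∈ A, ∀ N ∈ A, N % n ∈ A)
    (hadd : ∀ n ∈ A, ∀ m ∈ A, n + m ∈ A) (h0 : ∀ n, 0 ≤ F n) (h1 : ∀ n ∈ A, F n ≤ n)
    (hF : ∀ δ : ℝ, 0 < δ → ∃ C : ℝ, ∀ n ∈ A, ∀ m ∈ A, F n + F m ≤ F (n + m) + (δ * n + C)) :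
    ∃ H : ℝ, Tendsto (fun n => F n / n) (atTop ⊓ 𝓟 A) (𝓝 H) := by
  have hev : ∀ k : ℕ, ∀ᶠ n in atTop ⊓ 𝓟 A, k ≤ n ∧ n ∈ A := fun k =>
    ((eventually_ge_atTop k).filter_mono inf_le_left).and
      (eventually_inf_principal.2 (Eventually.of_forall fun _ h => h))
  have hle : ∀ n ∈ A, F n / n ≤ 1 := fun n hn => div_le_one_of_le₀ (h1 n hn) n.cast_nonneg
  have hbdd : IsBoundedUnder (· ≤ ·) (atTop ⊓ 𝓟 A) fun n => F n / n :=
    isBoundedUnder_of_eventually_le ((hev 0).mono fun n hn => hle n hn.2)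
  have hcobdd : IsCoboundedUnder (· ≤ ·) (atTop ⊓ 𝓟 A) fun n => F n / n :=
    (isBoundedUnder_of_eventually_ge (a := 0)
      (Eventually.of_forall fun n => div_nonneg (h0 n) n.cast_nonneg)).isCoboundedUnder_le
  refine ⟨limsup (fun n => F n / n) (atTop ⊓ 𝓟 A), tendsto_order.2 ⟨fun b hb => ?_, fun b hb =>
    eventually_lt_of_limsup_lt hb hbdd⟩⟩
  obtain ⟨b', hbb', hb'⟩ := exists_between hb
  set δ := (b' - b) / 4 with hδ
  have hδ0 : 0 < δ := by rw [hδ]; linarith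
  obtain ⟨C, hC⟩ := hF δ hδ0
  obtain ⟨k, hk⟩ := exists_nat_gt (max (C / δ) 0)
  obtain ⟨n, hn, hkn, hnA⟩ :=
    ((frequently_lt_of_lt_limsup hcobdd hb').and_eventually (hev k)).exists
  have hkn' : max (C / δ) 0 < (n : ℝ) := hk.trans_le (by exact_mod_cast hkn)
  have hn0 : (0 : ℝ) < n := (le_max_right _ _).trans_lt hkn'
  have hCn : C < δ * n := by
    have := (le_max_left _ _).trans_lt hkn'
    rwa [div_lt_iff₀' hδ0] at this
  set a := b' - 2 * δ with ha
  have han : a * n ≤ F n - δ * n - C := by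
    rw [lt_div_iff₀ hn0] at hn
    rw [ha]
    linarith
  have hmul : ∀ q : ℕ, ∀ ρ ∈ A, n * q + ρ ∈ A ∧ a * n * q ≤ F (n * q + ρ) := by
    intro q
    induction q with
    | zero => intro ρ hρ; simpa using ⟨hρ, h0 ρ⟩
    | succ q ih =>
      intro ρ hρ
      obtain ⟨h₁, h₂⟩ := ih ρ hρ
      rw [show n * (q + 1) + ρ = n + (n * q + ρ) by ring]
      refine ⟨hadd _ hnA _ h₁, ?_⟩
      have := hC n hnA _ h₁
      push_cast
      linarith
  have ha1 : a ≤ 1 := by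
    have := hle n hnA
    linarith
  obtain ⟨K, hK⟩ := exists_nat_gt (n / δ)
  filter_upwards [hev (K + 1)] with N hN
  have hN0 : (0 : ℝ) < N := by exact_mod_cast (by omega : 0 < N)
  have hKN : (n : ℝ) < δ * N := by
    rw [div_lt_iff₀' hδ0] at hK
    have : (K : ℝ) ≤ N := by exact_mod_cast (by omega : K ≤ N)
    exact hK.trans_le (by gcongr)
  rw [lt_div_iff₀ hN0]
  have hba : b = a - 2 * δ := by rw [ha, hδ]; ring
  rcases le_total a 0 with ha0 | ha0
  · refine lt_of_lt_of_le ?_ (h0 N)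
    exact mul_neg_of_neg_of_pos (by linarith) hN0
  · have h₁ := (hmul (N / n) _ (hmod n hnA N hN.2)).2
    rw [Nat.div_add_mod] at h₁
    have h₂ : (N : ℝ) - n ≤ n * (N / n : ℕ) := by
      have h₃ : N < n * (N / n) + n := Nat.lt_mul_div_succ N (by exact_mod_cast hn0)
      have : (N : ℝ) < n * (N / n : ℕ) + n := by exact_mod_cast h₃
      linarith
    have h₃ := mul_le_mul_of_nonneg_left h₂ ha0
    have h₄ := mul_le_mul_of_nonneg_right ha1 hn0.le
    have h₅ : 0 < δ * N := by positivity
    rw [hba, sub_mul]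
    linarith

theorem exists_tendsto_meanMaxIndep_div (r : ℕ) :
    ∃ H : ℝ, Tendsto (fun N : ℕ => meanMaxIndep N r / N) (atTop ⊓ 𝓟 {N : ℕ | Even (N * r)})
      (𝓝 H) := by
  refine exists_tendsto_div_of_almost_superadditive ?_ ?_ ?_ (fun N => meanMaxIndep_nonneg N r)
    (fun N hN => meanMaxIndep_le hN) fun δ hδ => ?_
  · rw [← frequently_mem_iff_neBot]
    refine frequently_atTop.2 fun k => ⟨2 * k, by omega, ?_⟩
    simp [mul_assoc]
  · intro n hn N hN
    have h : Even ((N % n) * r + n * r * (N / n)) := by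
      convert (show Even (N * r) from hN) using 1
      conv_rhs => rw [← Nat.mod_add_div N n]
      ring
    exact (Nat.even_add.1 h).2 ((show Even (n * r) from hn).mul_right _)
  · intro n hn m hm
    simpa [add_mul] using Even.add hn hm
  · obtain ⟨C, hC⟩ := exists_meanMaxIndep_add_le r hδ
    exact ⟨C, fun n hn m hm => hC n m hn hm⟩

theorem probReg_mono {N r : ℕ} {p q : Matching N r → Prop} (h : ∀ f, p f → q f) :
    probReg N r p ≤ probReg N r q := by
  unfold probReg
  gcongr with f
  exact h f

end ScalingLimit

/-- For the configuration-model random `r`-regular multigraph `G(N, r)`, the size of a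
largest independent set normalized by `N` converges with high probability to a constant
`H(r)` as `N → ∞` along integers `N` with `N * r` even. -/
theorem indep_set_scaling_limit_regular (r : ℕ) (hr : 1 ≤ r) :
    ∃ H : ℝ,
      ∀ ε : ℝ, 0 < ε →
        Tendsto (fun N : ℕ =>
            probReg N r (fun f => ε < |(maxIndepReg f : ℝ) / (N : ℝ) - H|))
          (atTop ⊓ 𝓟 {N : ℕ | Even (N * r)}) (nhds 0) := by
  obtain ⟨H, hH⟩ := exists_tendsto_meanMaxIndep_div r
  refine ⟨H, fun ε hε => ?_⟩
  have hlim : Tendsto (fun N : ℕ => 16 * r / ε ^ 2 * (N : ℝ)⁻¹)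
      (atTop ⊓ 𝓟 {N : ℕ | Even (N * r)}) (nhds 0) := by
    simpa using ((tendsto_inv_atTop_nhds_zero_nat (𝕜 := ℝ)).const_mul
      (16 * (r : ℝ) / ε ^ 2)).mono_left inf_le_left
  refine tendsto_of_tendsto_of_tendsto_of_le_of_le' tendsto_const_nhds hlim
    (Eventually.of_forall fun N => by unfold probReg; positivity) ?_
  filter_upwards [Metric.tendsto_nhds.1 hH (ε / 2) (half_pos hε),
    (eventually_gt_atTop 0).filter_mono inf_le_left,
    eventually_inf_principal.2 (Eventually.of_forall fun _ h => h)] with N hN hpos hev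
  have hN0 : (0 : ℝ) < N := by exact_mod_cast hpos
  have ht : 0 < ε / 2 * N := by positivity
  refine (probReg_mono fun f hf => ?_).trans
    ((probReg_lt_abs_sub_meanMaxIndep_le hev ht).trans_eq (by field_simp; norm_num))
  rw [Real.dist_eq] at hN
  have htri := abs_sub_le ((maxIndepReg f : ℝ) / N) (meanMaxIndep N r / N) H
  have hlt : ε / 2 < |(maxIndepReg f : ℝ) / N - meanMaxIndep N r / N| := by linarith
  rwa [← sub_div, abs_div, abs_of_pos hN0, lt_div_iff₀ hN0] at hlt
end

section
/- Fix a real constant c > 0 and an integer K ≥ 2. For every N and every N_1, N_2 with 1 ≤ N_1, N_2 ≤ N − 1 and N_1 + N_2 = N, let M_1 be a Binomial(⌊cN⌋, N_1/N) random variable and M_2 = ⌊cN⌋ − M_1; conditionally on M_1, let G_1 and G_2 be independent random K-SAT instances with N_1 variables and M_1 clauses, and N_2 variables and M_2 clauses, respectively. Then p(N, ⌊cN⌋) ≥ P(G_1 is satisfiable and G_2 is satisfiable), where p(N, M) is the probability that a random K-SAT instance with N variables and M clauses is satisfiable. -/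
open Filter
open scoped Classical

/-- A clause of a `K`-SAT instance on variables `Fin N`: `K` variable indices together
with the forbidden tuple `a ∈ {0,1}^K`. -/
abbrev Clause (N K : ℕ) := (Fin K → Fin N) × (Fin K → Bool)

/-- Probability of an event `p` for a random `K`-SAT instance with `N` variables and `M`
clauses: the `M` clauses (variable indices and forbidden tuples) are drawn independently
and uniformly at random. -/
noncomputable def probKSAT (N K M : ℕ) (p : (Fin M → Clause N K) → Prop) : ℝ :=
  (((Finset.univ : Finset (Fin M → Clause N K)).filter p).card : ℝ) /
    (Fintype.card (Fin M → Clause N K) : ℝ)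

/-- `pSat N K M` is the probability that a random `K`-SAT instance with `N` variables and
`M` clauses is satisfiable. -/
noncomputable def pSat (N K M : ℕ) : ℝ :=
  probKSAT N K M (fun C => ∃ x : Fin N → Bool,
    ∀ m : Fin M, (fun k => x ((C m).1 k)) ≠ (C m).2)

/-- `P(Binomial(M, θ) = m)`. -/
noncomputable def binomW (M : ℕ) (θ : ℝ) (m : ℕ) : ℝ :=
  (M.choose m : ℝ) * θ ^ m * (1 - θ) ^ (M - m)

/-- The total weight of the sequences of `n` constraints, each constraint `c` having weight `w c`
and solution set `sat c`, that leave at least one element of `S` feasible. -/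
noncomputable def feasibleWeight {ι X : Type*} [Fintype ι] (w : ι → ℝ) (sat : ι → Set X) :
    ℕ → Set X → ℝ
  | 0, S => if S.Nonempty then 1 else 0
  | n + 1, S => ∑ c, w c * feasibleWeight w sat n (S ∩ sat c)

section Comparison

variable {ι κ X : Type*} [Fintype ι] [Fintype κ]

theorem sum_mul_feasibleWeight_le (u : κ → ℝ) (satu : κ → Set X) (w : ι → ℝ) (sat : ι → Set X)
    (hu : ∀ c, 0 ≤ u c)
    (h : ∀ S : Set X, ∑ c, u c * feasibleWeight u satu 0 (S ∩ satu c) ≤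
      ∑ c, w c * feasibleWeight u satu 0 (S ∩ sat c)) (n : ℕ) (S : Set X) :
    ∑ c, u c * feasibleWeight u satu n (S ∩ satu c) ≤
      ∑ c, w c * feasibleWeight u satu n (S ∩ sat c) := by
  induction n generalizing S with
  | zero => exact h S
  | succ n ih =>
    calc ∑ c, u c * feasibleWeight u satu (n + 1) (S ∩ satu c)
        ≤ ∑ d, u d * ∑ c, w c * feasibleWeight u satu n (S ∩ satu d ∩ sat c) :=
          Finset.sum_le_sum fun d _ => mul_le_mul_of_nonneg_left (ih _) (hu d)
      _ = ∑ c, w c * feasibleWeight u satu (n + 1) (S ∩ sat c) := by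
          simp only [feasibleWeight, Finset.mul_sum]
          rw [Finset.sum_comm]
          refine Finset.sum_congr rfl fun c _ => Finset.sum_congr rfl fun d _ => ?_
          rw [Set.inter_right_comm, mul_left_comm]

/-- If one random constraint with weights `w` is at least as likely to preserve feasibility as one
with weights `u`, whatever the current feasible set, then so are `n` of them. -/
theorem feasibleWeight_le_feasibleWeight (u : κ → ℝ) (satu : κ → Set X) (w : ι → ℝ)
    (sat : ι → Set X) (hu : ∀ c, 0 ≤ u c) (hw : ∀ c, 0 ≤ w c)
    (h : ∀ S : Set X, ∑ c, u c * feasibleWeight u satu 0 (S ∩ satu c) ≤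
      ∑ c, w c * feasibleWeight u satu 0 (S ∩ sat c)) (n : ℕ) (S : Set X) :
    feasibleWeight u satu n S ≤ feasibleWeight w sat n S := by
  induction n generalizing S with
  | zero => exact le_rfl
  | succ n ih =>
    exact (sum_mul_feasibleWeight_le u satu w sat hu h n S).trans
      (Finset.sum_le_sum fun c _ => mul_le_mul_of_nonneg_left (ih _) (hw c))

end Comparison

theorem feasibleWeight_sum_elim {ι κ X Y Z : Type*} [Fintype ι] [Fintype κ]
    (w : ι → ℝ) (sat : ι → Set X) (u : κ → ℝ) (satu : κ → Set Y) (f : Z → X) (g : Z → Y)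
    (hfg : Function.Surjective fun z => (f z, g z)) (θ : ℝ) (n : ℕ) (S : Set X) (T : Set Y) :
    feasibleWeight (Sum.elim (fun c => θ * w c) (fun c => (1 - θ) * u c))
        (Sum.elim (fun c => f ⁻¹' sat c) (fun c => g ⁻¹' satu c)) n (f ⁻¹' S ∩ g ⁻¹' T) =
      ∑ m ∈ Finset.range (n + 1),
        binomW n θ m * (feasibleWeight w sat m S * feasibleWeight u satu (n - m) T) := by
  have key : ∀ (n : ℕ) (S : Set X) (T : Set Y),
      feasibleWeight (Sum.elim (fun c => θ * w c) (fun c => (1 - θ) * u c))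
        (Sum.elim (fun c => f ⁻¹' sat c) (fun c => g ⁻¹' satu c)) n (f ⁻¹' S ∩ g ⁻¹' T) =
      ∑ ij ∈ Finset.HasAntidiagonal.antidiagonal n, (n.choose ij.1 : ℝ) *
        (θ ^ ij.1 * (1 - θ) ^ ij.2 *
          (feasibleWeight w sat ij.1 S * feasibleWeight u satu ij.2 T)) := by
    intro n
    induction n with
    | zero =>
      intro S T
      have hne : (f ⁻¹' S ∩ g ⁻¹' T).Nonempty ↔ S.Nonempty ∧ T.Nonempty := by
        constructor
        · rintro ⟨z, hz, hz'⟩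
          exact ⟨⟨_, hz⟩, ⟨_, hz'⟩⟩
        · rintro ⟨⟨x, hx⟩, ⟨y, hy⟩⟩
          obtain ⟨z, hz⟩ := hfg (x, y)
          obtain ⟨rfl, rfl⟩ := Prod.mk.inj hz
          exact ⟨z, hx, hy⟩
      by_cases hS : S.Nonempty <;> by_cases hT : T.Nonempty <;>
        simp [feasibleWeight, hne, hS, hT]
    | succ n ih =>
      intro S T
      rw [feasibleWeight, Fintype.sum_sum_type, Finset.sum_antidiagonal_choose_succ_mul (fun i j => θ ^ i * (1 - θ) ^ j *
          (feasibleWeight w sat i S * feasibleWeight u satu j T))]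
      refine Eq.trans ?_ (add_comm _ _)
      simp only [Sum.elim_inl, Sum.elim_inr]
      congr 1
      · have hset : ∀ c, f ⁻¹' S ∩ g ⁻¹' T ∩ f ⁻¹' sat c = f ⁻¹' (S ∩ sat c) ∩ g ⁻¹' T :=
          fun c => by rw [Set.inter_right_comm, Set.preimage_inter]
        simp only [hset, ih, feasibleWeight, Finset.mul_sum, Finset.sum_mul]
        rw [Finset.sum_comm]
        refine Finset.sum_congr rfl fun ij hij => Finset.sum_congr rfl fun c _ => ?_
        rw [Nat.choose_symm_of_eq_add (Finset.HasAntidiagonal.mem_antidiagonal.1 hij).symm]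
        ring
      · have hset : ∀ c, f ⁻¹' S ∩ g ⁻¹' T ∩ g ⁻¹' satu c = f ⁻¹' S ∩ g ⁻¹' (T ∩ satu c) :=
          fun c => by rw [Set.inter_assoc, Set.preimage_inter]
        simp only [hset, ih, feasibleWeight, Finset.mul_sum]
        rw [Finset.sum_comm]
        refine Finset.sum_congr rfl fun ij _ => Finset.sum_congr rfl fun c _ => ?_
        ring
  rw [key, Finset.Nat.sum_antidiagonal_eq_sum_range_succ_mk]
  refine Finset.sum_congr rfl fun m _ => ?_
  simp only [binomW]
  ring

/-- The assignments of `V` whose restriction along `e` satisfies the clause `c`. -/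
def clauseSolutions {V : Type*} {n K : ℕ} (e : Fin n → V) (c : Clause n K) : Set (V → Bool) :=
  {x | (fun k => x (e (c.1 k))) ≠ c.2}

/-- The probability of each clause under the uniform distribution. -/
noncomputable def clauseWeight (n K : ℕ) : ℝ := (Fintype.card (Clause n K) : ℝ)⁻¹

theorem clauseWeight_nonneg (n K : ℕ) : 0 ≤ clauseWeight n K := by
  unfold clauseWeight
  positivity

theorem feasibleWeight_const {ι X : Type*} [Fintype ι] (a : ℝ) (sat : ι → Set X) (n : ℕ)
    (S : Set X) :
    feasibleWeight (fun _ => a) sat n S =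
      a ^ n * ∑ C : Fin n → ι, if ∃ x ∈ S, ∀ m, x ∈ sat (C m) then (1 : ℝ) else 0 := by
  induction n generalizing S with
  | zero =>
    simp [feasibleWeight, Set.Nonempty]
    congr
  | succ n ih =>
    rw [← Fintype.sum_equiv (Fin.consEquiv fun _ => ι)
      (fun p : ι × (Fin n → ι) => if ∃ x ∈ S ∩ sat p.1, ∀ m, x ∈ sat (p.2 m) then (1 : ℝ) else 0)
      _ (fun p => by simp [Fin.consEquiv, Fin.forall_fin_succ, and_assoc]), Fintype.sum_prod_type]
    simp only [feasibleWeight, ih, Finset.mul_sum]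
    refine Finset.sum_congr rfl fun c _ => Finset.sum_congr rfl fun C _ => ?_
    ring

theorem pSat_eq_feasibleWeight (n K M : ℕ) :
    pSat n K M =
      feasibleWeight (fun _ => clauseWeight n K) (clauseSolutions (K := K) (id : Fin n → Fin n)) M
        Set.univ := by
  rw [feasibleWeight_const, pSat, probKSAT, clauseWeight, div_eq_mul_inv, mul_comm,
    Fintype.card_fun, Fintype.card_fin, Nat.cast_pow, inv_pow, ← Finset.sum_boole]
  congr! 4
  simp [clauseSolutions]

/-- The variables whose image under `e` takes the same value in all assignments in `S`. -/
noncomputable def frozenVars {V : Type*} {n : ℕ} (e : Fin n → V) (S : Set (V → Bool)) :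
    Finset (Fin n) :=
  Finset.univ.filter fun v => ∀ x ∈ S, ∀ y ∈ S, x (e v) = y (e v)

theorem card_violated_clauses {V : Type*} {n : ℕ} (K : ℕ) (e : Fin n → V) {S : Set (V → Bool)}
    (hS : S.Nonempty) :
    (Finset.univ.filter fun c : Clause n K => ¬ (S ∩ clauseSolutions e c).Nonempty).card =
      (frozenVars e S).card ^ K := by
  obtain ⟨x₀, hx₀⟩ := hS
  have himage : (Finset.univ.filter fun c : Clause n K =>
      ¬ (S ∩ clauseSolutions e c).Nonempty) =
      (Fintype.piFinset fun _ : Fin K => frozenVars e S).image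
        (fun i => (i, fun k => x₀ (e (i k)))) := by
    ext ⟨i, a⟩
    simp only [Finset.mem_filter, Finset.mem_univ, true_and, Set.not_nonempty_iff_eq_empty,
      Set.eq_empty_iff_forall_notMem, Set.mem_inter_iff, clauseSolutions, Set.mem_ofPred_eq,
      not_and, not_not, Finset.mem_image, Fintype.mem_piFinset, frozenVars, Prod.mk.injEq]
    constructor
    · intro h
      refine ⟨i, fun k x hx y hy => ?_, rfl, h x₀ hx₀⟩
      exact (congrFun (h x hx) k).trans (congrFun (h y hy) k).symm
    · rintro ⟨j, hj, rfl, rfl⟩ x hx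
      exact funext fun k => hj k x hx x₀ hx₀
  rw [himage, Finset.card_image_of_injective _ fun i j h => (Prod.mk.inj h).1]
  simp

theorem sum_clauseWeight_feasible {V : Type*} {n : ℕ} (K : ℕ) (hn : 1 ≤ n) (e : Fin n → V)
    {S : Set (V → Bool)} (hS : S.Nonempty) :
    ∑ c : Clause n K, clauseWeight n K *
        (if (S ∩ clauseSolutions e c).Nonempty then (1 : ℝ) else 0) =
      1 - ((frozenVars e S).card / n : ℝ) ^ K / 2 ^ K := by
  have hcard : Fintype.card (Clause n K) = n ^ K * 2 ^ K := by simp [Clause]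
  have hsplit := Finset.card_filter_add_card_filter_not (s := (Finset.univ : Finset (Clause n K)))
    (fun c => (S ∩ clauseSolutions e c).Nonempty)
  rw [card_violated_clauses K e hS, Finset.card_univ, hcard] at hsplit
  have hsplit' := congrArg (Nat.cast : ℕ → ℝ) hsplit
  push_cast at hsplit'
  have hn' : (n : ℝ) ≠ 0 := by positivity
  rw [← Finset.mul_sum, Finset.sum_boole, clauseWeight, hcard, eq_sub_of_add_eq hsplit', div_pow]
  push_cast
  field_simp

theorem card_frozenVars_add {n₁ n₂ : ℕ} (S : Set (Fin (n₁ + n₂) → Bool)) :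
    (frozenVars id S).card =
      (frozenVars (Fin.castAdd n₂) S).card + (frozenVars (Fin.natAdd n₁) S).card := by
  simp only [frozenVars, Finset.card_filter, Fin.sum_univ_add, id]
  congr!

theorem add_div_add_pow_le (K : ℕ) {a b p q : ℝ} (ha : 0 < a) (hb : 0 < b) (hp : 0 ≤ p)
    (hq : 0 ≤ q) :
    ((p + q) / (a + b)) ^ K ≤ a / (a + b) * (p / a) ^ K + b / (a + b) * (q / b) ^ K := by
  have h := (convexOn_pow K).2 (Set.mem_Ici.2 (div_nonneg hp ha.le))
    (Set.mem_Ici.2 (div_nonneg hq hb.le)) (by positivity : 0 ≤ a / (a + b))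
    (by positivity : 0 ≤ b / (a + b)) (by field_simp)
  simp only [smul_eq_mul] at h
  have hmean : a / (a + b) * (p / a) + b / (a + b) * (q / b) = (p + q) / (a + b) := by field_simp
  rwa [hmean] at h

theorem sum_split_clause_le_sum_clause {n₁ n₂ : ℕ} (K : ℕ) (h₁ : 1 ≤ n₁) (h₂ : 1 ≤ n₂)
    (S : Set (Fin (n₁ + n₂) → Bool)) :
    (n₁ : ℝ) / (n₁ + n₂) * (∑ c : Clause n₁ K, clauseWeight n₁ K *
        if (S ∩ clauseSolutions (Fin.castAdd n₂) c).Nonempty then (1 : ℝ) else 0) +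
      (n₂ : ℝ) / (n₁ + n₂) * (∑ c : Clause n₂ K, clauseWeight n₂ K *
        if (S ∩ clauseSolutions (Fin.natAdd n₁) c).Nonempty then (1 : ℝ) else 0) ≤
      ∑ c : Clause (n₁ + n₂) K, clauseWeight (n₁ + n₂) K *
        if (S ∩ clauseSolutions id c).Nonempty then (1 : ℝ) else 0 := by
  rcases S.eq_empty_or_nonempty with rfl | hS
  · simp
  have ha : (0 : ℝ) < n₁ := by positivity
  have hb : (0 : ℝ) < n₂ := by positivity
  rw [sum_clauseWeight_feasible K h₁ _ hS, sum_clauseWeight_feasible K h₂ _ hS,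
    sum_clauseWeight_feasible K (h₁.trans (Nat.le_add_right _ _)) _ hS, card_frozenVars_add]
  push_cast
  have hconv := div_le_div_of_nonneg_right (add_div_add_pow_le K ha hb
    (Nat.cast_nonneg (frozenVars (Fin.castAdd n₂) S).card)
    (Nat.cast_nonneg (frozenVars (Fin.natAdd n₁) S).card))
    (by positivity : (0 : ℝ) ≤ 2 ^ K)
  have hone : (n₁ : ℝ) / (n₁ + n₂) + (n₂ : ℝ) / (n₁ + n₂) = 1 := by field_simp
  rw [add_div (_ * _), mul_div_assoc, mul_div_assoc] at hconv
  linarith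

/-- Interpolation inequality for `K`-SAT satisfiability probabilities: with
`M₁ ~ Binomial(⌊cN⌋, N₁/N)`, `M₂ = ⌊cN⌋ - M₁`, and `G₁, G₂` conditionally independent
random `K`-SAT instances on `N₁` and `N₂` variables with `M₁` and `M₂` clauses,
`p(N, ⌊cN⌋) ≥ P(G₁ satisfiable and G₂ satisfiable)`; the right-hand side is written out
by conditioning on `M₁`. -/
theorem ksat_sat_prob_interpolation (c : ℝ) (hc : 0 < c) (K : ℕ) (hK : 2 ≤ K)
    (N N₁ N₂ : ℕ) (h₁ : 1 ≤ N₁) (h₁' : N₁ ≤ N - 1) (h₂ : 1 ≤ N₂) (h₂' : N₂ ≤ N - 1)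
    (hsum : N₁ + N₂ = N) :
    pSat N K ⌊c * (N : ℝ)⌋₊ ≥
      ∑ m ∈ Finset.range (⌊c * (N : ℝ)⌋₊ + 1),
        binomW ⌊c * (N : ℝ)⌋₊ ((N₁ : ℝ) / (N : ℝ)) m *
          (pSat N₁ K m * pSat N₂ K (⌊c * (N : ℝ)⌋₊ - m)) := by
  subst hsum
  generalize ⌊c * ((N₁ + N₂ : ℕ) : ℝ)⌋₊ = M
  have hpos : (0 : ℝ) < N₁ + N₂ := by positivity
  have hcompl : 1 - (N₁ : ℝ) / (N₁ + N₂) = (N₂ : ℝ) / (N₁ + N₂) := by field_simp; ring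
  have hsurj : Function.Surjective fun x : Fin (N₁ + N₂) → Bool =>
      ((fun v => x (Fin.castAdd N₂ v)), (fun v => x (Fin.natAdd N₁ v))) := by
    rintro ⟨y, z⟩
    exact ⟨Fin.append y z, by simp⟩
  simp only [pSat_eq_feasibleWeight]
  rw [← feasibleWeight_sum_elim _ _ _ _ _ _ hsurj, Set.preimage_univ, Set.preimage_univ,
    Set.univ_inter]
  push_cast
  rw [hcompl]
  refine feasibleWeight_le_feasibleWeight _ _ _ _ ?_ (fun _ => clauseWeight_nonneg _ _) ?_ M _
  · rintro (c | c)
    all_goals exact mul_nonneg (by positivity) (clauseWeight_nonneg _ _)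
  · intro S
    rw [Fintype.sum_sum_type]
    simp only [Sum.elim_inl, Sum.elim_inr, mul_assoc, ← Finset.mul_sum, feasibleWeight]
    have h := sum_split_clause_le_sum_clause K h₁ h₂ S
    simp only [← Finset.mul_sum] at h
    exact h
end

section
/- Fix real constants c > 0 and λ > 1. For every N and every N_1, N_2 with 1 ≤ N_1, N_2 ≤ N − 1 and N_1 + N_2 = N, let M_1 be a Binomial(⌊cN⌋, N_1/N) random variable and M_2 = ⌊cN⌋ − M_1; conditionally on M_1, let G(N_1, M_1) and G(N_2, M_2) be independent Erdős–Rényi directed multigraphs on [N_1] and [N_2] with M_1 and M_2 edges respectively. Then E[log Z(G(N, ⌊cN⌋))] ≥ E[log Z(G(N_1, M_1))] + E[log Z(G(N_2, M_2))], where Z(G) = Σ_{S independent in G} λ^{|S|} is the hard-core partition function. -/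
open Filter
open scoped Classical

/-- Expectation of `f` when an edge list of `M` directed edges on vertex set `Fin N` is
drawn uniformly at random (i.e. the `M` edges are i.i.d. uniform ordered pairs). -/
noncomputable def expER (N M : ℕ) (f : (Fin M → Fin N × Fin N) → ℝ) : ℝ :=
  (∑ E : Fin M → Fin N × Fin N, f E) / (Fintype.card (Fin M → Fin N × Fin N) : ℝ)

/-- `S` is an independent set for the edge list `E`: no edge has both endpoints in `S`. -/
def IsIndepSet {N M : ℕ} (E : Fin M → Fin N × Fin N) (S : Finset (Fin N)) : Prop :=
  ∀ m : Fin M, ¬((E m).1 ∈ S ∧ (E m).2 ∈ S)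

/-- The hard-core partition function `Z(G) = Σ_{S independent} λ^{|S|}` (the empty set is
included, so `Z(G) ≥ 1`). -/
noncomputable def hardCoreZ (lam : ℝ) {N M : ℕ} (E : Fin M → Fin N × Fin N) : ℝ :=
  ∑ S ∈ (Finset.univ : Finset (Finset (Fin N))).filter (IsIndepSet E), lam ^ S.card

section Interpolation

open Matrix

variable {V : Type*}

/-- The quadratic form of the entrywise `-log (1 - Q)` is nonnegative when `Q` is positive
semidefinite with entries of absolute value less than one. -/
theorem sum_mul_log_one_sub_nonpos [Fintype V] {Q : Matrix V V ℝ} (hQ : Q.PosSemidef)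
    (hQ1 : ∀ i j, |Q i j| < 1) (x : V → ℝ) :
    ∑ i, ∑ j, x i * x j * Real.log (1 - Q i j) ≤ 0 := by
  have hpow : ∀ k : ℕ, (Matrix.of fun i j => Q i j ^ (k + 1)).PosSemidef := by
    intro k
    induction k with
    | zero => simp only [zero_add, pow_one]; exact hQ
    | succ k ih => exact ih.hadamard hQ
  have hs : HasSum (fun k : ℕ => ∑ i, ∑ j, x i * x j * (Q i j ^ (k + 1) / (k + 1)))
      (∑ i, ∑ j, x i * x j * -Real.log (1 - Q i j)) :=
    hasSum_sum fun i _ => hasSum_sum fun j _ =>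
      (Real.hasSum_pow_div_log_of_abs_lt_one (hQ1 i j)).mul_left _
  have hnonneg := hs.nonneg fun k => by
    have h := (hpow k).dotProduct_mulVec_nonneg x
    have h' : ∑ i, ∑ j, x i * x j * (Q i j ^ (k + 1) / (k + 1)) =
        (star x ⬝ᵥ (Matrix.of fun i j => Q i j ^ (k + 1)) *ᵥ x) / (k + 1) := by
      simp only [dotProduct, mulVec, Matrix.of_apply, Finset.mul_sum, Finset.sum_div,
        Pi.star_apply, star_trivial]
      refine Finset.sum_congr rfl fun i _ => Finset.sum_congr rfl fun j _ => ?_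
      ring
    rw [h']
    positivity
  simpa using hnonneg

/-- The hard-core weight of `S` for the edge set `A`. -/
noncomputable def hardCoreWeight (lam : ℝ) (A : Set (V × V)) (S : Finset V) : ℝ :=
  if ∀ e ∈ A, ¬(e.1 ∈ S ∧ e.2 ∈ S) then lam ^ S.card else 0

/-- The hard-core partition function of the graph with edge set `A`. -/
noncomputable def edgeSetZ [Fintype V] (lam : ℝ) (A : Set (V × V)) : ℝ :=
  ∑ S : Finset V, hardCoreWeight lam A S

theorem hardCoreWeight_nonneg {lam : ℝ} (hlam : 0 < lam) (A : Set (V × V)) (S : Finset V) :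
    0 ≤ hardCoreWeight lam A S := by
  unfold hardCoreWeight
  split_ifs <;> positivity

theorem edgeSetZ_pos [Fintype V] {lam : ℝ} (hlam : 0 < lam) (A : Set (V × V)) :
    0 < edgeSetZ lam A := by
  refine Finset.sum_pos' (fun S _ => hardCoreWeight_nonneg hlam A S) ⟨∅, Finset.mem_univ _, ?_⟩
  simp [hardCoreWeight]

theorem hardCoreWeight_insert (lam : ℝ) (A : Set (V × V)) (i j : V) (S : Finset V) :
    hardCoreWeight lam (insert (i, j) A) S = hardCoreWeight lam A S -
      hardCoreWeight lam A S * ((if i ∈ S then 1 else 0) * (if j ∈ S then 1 else 0)) := by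
  unfold hardCoreWeight
  by_cases hi : i ∈ S <;> by_cases hj : j ∈ S <;> simp [hi, hj]

/-- The probability under the hard-core measure that both `i` and `j` are occupied. -/
noncomputable def pairOccupancy [Fintype V] (lam : ℝ) (A : Set (V × V)) : Matrix V V ℝ :=
  ∑ S : Finset V, (hardCoreWeight lam A S / edgeSetZ lam A) •
    vecMulVec (fun i => if i ∈ S then (1 : ℝ) else 0) (fun i => if i ∈ S then (1 : ℝ) else 0)

theorem edgeSetZ_insert [Fintype V] {lam : ℝ} (hlam : 0 < lam) (A : Set (V × V)) (i j : V) :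
    edgeSetZ lam (insert (i, j) A) = edgeSetZ lam A * (1 - pairOccupancy lam A i j) := by
  have hZ := (edgeSetZ_pos hlam A).ne'
  rw [pairOccupancy, Matrix.sum_apply, mul_sub, Finset.mul_sum, mul_one]
  nth_rw 1 [edgeSetZ]
  nth_rw 1 [edgeSetZ]
  rw [← Finset.sum_sub_distrib]
  refine Finset.sum_congr rfl fun S _ => ?_
  rw [hardCoreWeight_insert, Matrix.smul_apply, vecMulVec_apply, smul_eq_mul]
  field_simp

theorem pairOccupancy_posSemidef [Fintype V] {lam : ℝ} (hlam : 0 < lam) (A : Set (V × V)) :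
    (pairOccupancy lam A).PosSemidef := by
  refine posSemidef_sum _ fun S _ => PosSemidef.smul ?_
    (div_nonneg (hardCoreWeight_nonneg hlam A S) (edgeSetZ_pos hlam A).le)
  simpa using posSemidef_vecMulVec_self_star (fun i => if i ∈ S then (1 : ℝ) else 0)

theorem abs_pairOccupancy_lt_one [Fintype V] {lam : ℝ} (hlam : 0 < lam) (A : Set (V × V))
    (i j : V) : |pairOccupancy lam A i j| < 1 := by
  have hZ := edgeSetZ_pos hlam A
  have h := edgeSetZ_pos hlam (insert (i, j) A)
  rw [edgeSetZ_insert hlam] at h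
  have h0 : 0 ≤ pairOccupancy lam A i j := by
    rw [pairOccupancy, Matrix.sum_apply]
    refine Finset.sum_nonneg fun S _ => ?_
    rw [Matrix.smul_apply, vecMulVec_apply, smul_eq_mul]
    have := hardCoreWeight_nonneg hlam A S
    positivity
  rw [abs_of_nonneg h0]
  linarith [pos_of_mul_pos_right h hZ.le]

theorem sum_mul_log_edgeSetZ_insert_nonpos [Fintype V] {lam : ℝ} (hlam : 0 < lam)
    (A : Set (V × V)) (x : V → ℝ) (hx : ∑ i, x i = 0) :
    ∑ i, ∑ j, x i * x j * Real.log (edgeSetZ lam (insert (i, j) A)) ≤ 0 := by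
  have hZ := (edgeSetZ_pos hlam A).ne'
  have hlog : ∀ i j, Real.log (edgeSetZ lam (insert (i, j) A)) =
      Real.log (edgeSetZ lam A) + Real.log (1 - pairOccupancy lam A i j) := fun i j => by
    rw [edgeSetZ_insert hlam, Real.log_mul hZ]
    have := (abs_lt.mp (abs_pairOccupancy_lt_one hlam A i j)).2
    linarith
  simp only [hlog, mul_add, Finset.sum_add_distrib]
  rw [← Finset.sum_congr rfl fun i _ => Finset.sum_mul _ _ _]
  simp only [← Finset.mul_sum, hx, mul_zero, zero_mul, Finset.sum_const_zero, zero_add]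
  simpa only [Finset.mul_sum] using sum_mul_log_one_sub_nonpos
    (pairOccupancy_posSemidef hlam A) (abs_pairOccupancy_lt_one hlam A) x

/-- The operator on functions of edge sets that inserts the edge `e`. -/
def edgeOp (e : V × V) : Module.End ℝ (Set (V × V) → ℝ) :=
  LinearMap.funLeft ℝ ℝ (insert e)

theorem edgeOp_apply (e : V × V) (F : Set (V × V) → ℝ) (A : Set (V × V)) :
    edgeOp e F A = F (insert e A) := rfl

theorem edgeOp_commute (e e' : V × V) : Commute (edgeOp e) (edgeOp e') := by
  refine LinearMap.ext fun F => funext fun A => ?_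
  simp only [Module.End.mul_apply, edgeOp_apply, Set.insert_comm]

/-- The operator that inserts the image under `φ` of a uniformly random ordered pair. -/
noncomputable def avgOp {n : ℕ} (φ : Fin n → V) : Module.End ℝ (Set (V × V) → ℝ) :=
  ((n : ℝ) ^ 2)⁻¹ • ∑ e : Fin n × Fin n, edgeOp (φ e.1, φ e.2)

theorem avgOp_apply {n : ℕ} (φ : Fin n → V) (F : Set (V × V) → ℝ) (A : Set (V × V)) :
    avgOp φ F A =
      ((n : ℝ) ^ 2)⁻¹ * ∑ e : Fin n × Fin n, F (insert (φ e.1, φ e.2) A) := by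
  simp [avgOp, LinearMap.sum_apply, Finset.sum_apply, edgeOp_apply]

theorem avgOp_commute {n m : ℕ} (φ : Fin n → V) (ψ : Fin m → V) :
    Commute (avgOp φ) (avgOp ψ) :=
  ((Commute.sum_left _ _ _ fun _ _ => Commute.sum_right _ _ _ fun _ _ =>
    edgeOp_commute _ _).smul_left _).smul_right _

theorem avgOp_monotone {n : ℕ} (φ : Fin n → V) : Monotone (avgOp φ) := by
  intro F G h A
  rw [avgOp_apply, avgOp_apply]
  have := Finset.sum_le_sum fun e (_ : e ∈ (Finset.univ : Finset (Fin n × Fin n))) =>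
    h (insert (φ e.1, φ e.2) A)
  gcongr

theorem avgOp_pow_apply {n : ℕ} (φ : Fin n → V) (M : ℕ) (F : Set (V × V) → ℝ)
    (A : Set (V × V)) :
    (avgOp φ ^ M) F A = expER n M (fun E => F (Set.range (Prod.map φ φ ∘ E) ∪ A)) := by
  induction M generalizing F with
  | zero => simp [expER]
  | succ M ih =>
    rw [pow_succ, Module.End.mul_apply, ih]
    unfold expER
    simp only [avgOp_apply, ← Finset.mul_sum]
    rw [← (Fin.consEquiv fun _ => Fin n × Fin n).sum_comp, Fintype.sum_prod_type,
      Finset.sum_comm]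
    have hcons : ∀ (e : Fin n × Fin n) (E : Fin M → Fin n × Fin n),
        Set.range (Prod.map φ φ ∘ (Fin.consEquiv fun _ => Fin n × Fin n) (e, E)) ∪ A =
          insert (φ e.1, φ e.2) (Set.range (Prod.map φ φ ∘ E) ∪ A) := fun e E => by
      rw [← Set.insert_union, Set.range_comp, Set.range_comp]
      simp only [Fin.consEquiv, Equiv.coe_fn_mk, Fin.range_cons, Set.image_insert_eq, Prod.map]
    simp only [hcons, Fintype.card_fun, Fintype.card_prod, Fintype.card_fin]
    push_cast
    rw [pow_succ, inv_mul_eq_div, div_div]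
    ring_nf

theorem pow_apply_le_pow_apply_of_commute {X : Type*} {S T : Module.End ℝ (X → ℝ)}
    (hST : Commute S T) (hS : Monotone S) (hT : Monotone T) {F : X → ℝ} (hF : T F ≤ S F)
    (M : ℕ) : (T ^ M) F ≤ (S ^ M) F := by
  induction M with
  | zero => simp
  | succ M ih =>
    have hSM : Monotone ⇑(S ^ M) := by
      rw [Module.End.coe_pow]
      exact hS.iterate M
    calc (T ^ (M + 1)) F = T ((T ^ M) F) := by rw [pow_succ', Module.End.mul_apply]
      _ ≤ T ((S ^ M) F) := hT ih
      _ = (S ^ M) (T F) := by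
        rw [← Module.End.mul_apply, ← Module.End.mul_apply, (hST.pow_left M).eq]
      _ ≤ (S ^ M) (S F) := hSM hF
      _ = (S ^ (M + 1)) F := by rw [pow_succ, Module.End.mul_apply]

theorem hardCoreZ_eq_edgeSetZ (lam : ℝ) {N M : ℕ} (E : Fin M → Fin N × Fin N) :
    hardCoreZ lam E = edgeSetZ lam (Set.range E) := by
  unfold hardCoreZ edgeSetZ hardCoreWeight IsIndepSet
  rw [Finset.sum_filter]
  refine Finset.sum_congr rfl fun S _ => ?_
  congr 1
  simp only [Set.forall_mem_range]

theorem edgeSetZ_union_eq_mul (lam : ℝ) {n₁ n₂ : ℕ} (A : Set (Fin n₁ × Fin n₁))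
    (B : Set (Fin n₂ × Fin n₂)) :
    edgeSetZ lam (Prod.map (Fin.castAdd n₂) (Fin.castAdd n₂) '' A ∪
      Prod.map (Fin.natAdd n₁) (Fin.natAdd n₁) '' B) = edgeSetZ lam A * edgeSetZ lam B := by
  unfold edgeSetZ
  rw [Finset.sum_mul_sum, ← Fintype.sum_prod_type', ← (Finset.sumEquiv.symm.toEquiv.trans
    (finSumFinEquiv (m := n₁) (n := n₂)).finsetCongr).sum_comp]
  refine Finset.sum_congr rfl fun ⟨S, T⟩ _ => ?_
  have hl : ∀ i : Fin n₁, Fin.castAdd n₂ i ∈ (Finset.disjSum S T).map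
      (finSumFinEquiv (m := n₁) (n := n₂)).toEmbedding ↔ i ∈ S := fun i => by
    rw [← finSumFinEquiv_apply_left, Finset.mem_map_equiv]
    simp
  have hr : ∀ i : Fin n₂, Fin.natAdd n₁ i ∈ (Finset.disjSum S T).map
      (finSumFinEquiv (m := n₁) (n := n₂)).toEmbedding ↔ i ∈ T := fun i => by
    rw [← finSumFinEquiv_apply_right, Finset.mem_map_equiv]
    simp
  change hardCoreWeight lam _ ((Finset.disjSum S T).map
    (finSumFinEquiv (m := n₁) (n := n₂)).toEmbedding) = _
  unfold hardCoreWeight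
  simp only [Set.mem_union, or_imp, forall_and, Set.forall_mem_image, Prod.map_fst, Prod.map_snd,
    hl, hr, Finset.card_map, Finset.card_disjSum]
  rw [ite_zero_mul_ite_zero, pow_add]

/-- One edge of the full graph against one edge of the disjoint union. -/
theorem avgOp_split_le {lam : ℝ} (hlam : 0 < lam) {n₁ n₂ : ℕ} (h₁ : 1 ≤ n₁) (h₂ : 1 ≤ n₂) :
    (((n₁ : ℝ) / ((n₁ + n₂ : ℕ) : ℝ)) • avgOp (Fin.castAdd n₂ : Fin n₁ → Fin (n₁ + n₂)) +
      (1 - (n₁ : ℝ) / ((n₁ + n₂ : ℕ) : ℝ)) • avgOp (Fin.natAdd n₁ : Fin n₂ → Fin (n₁ + n₂)))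
        (fun A => Real.log (edgeSetZ lam A)) ≤
      avgOp (id : Fin (n₁ + n₂) → Fin (n₁ + n₂)) (fun A => Real.log (edgeSetZ lam A)) := by
  intro A
  have p₁ : (0 : ℝ) < n₁ := by exact_mod_cast h₁
  have p₂ : (0 : ℝ) < n₂ := by exact_mod_cast h₂
  have key := sum_mul_log_edgeSetZ_insert_nonpos hlam A
    (Fin.append (fun _ : Fin n₁ => (n₁ : ℝ)⁻¹) (fun _ : Fin n₂ => -(n₂ : ℝ)⁻¹)) (by
      simp [Fin.sum_univ_add, p₁.ne', p₂.ne'])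
  simp only [LinearMap.add_apply, LinearMap.smul_apply, Pi.add_apply, Pi.smul_apply, smul_eq_mul,
    avgOp_apply, Fintype.sum_prod_type, Fin.sum_univ_add, Fin.append_left, Fin.append_right, id,
    Finset.sum_add_distrib, ← Finset.mul_sum] at key ⊢
  push_cast
  generalize (∑ i : Fin n₁, ∑ j : Fin n₁, Real.log (edgeSetZ lam
    (insert (Fin.castAdd n₂ i, Fin.castAdd n₂ j) A))) = a at *
  generalize (∑ i : Fin n₁, ∑ j : Fin n₂, Real.log (edgeSetZ lam
    (insert (Fin.castAdd n₂ i, Fin.natAdd n₁ j) A))) = b at *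
  generalize (∑ i : Fin n₂, ∑ j : Fin n₁, Real.log (edgeSetZ lam
    (insert (Fin.natAdd n₁ i, Fin.castAdd n₂ j) A))) = c at *
  generalize (∑ i : Fin n₂, ∑ j : Fin n₂, Real.log (edgeSetZ lam
    (insert (Fin.natAdd n₁ i, Fin.natAdd n₁ j) A))) = d at *
  rw [← sub_nonpos]
  refine (?_ : _ = (n₁ : ℝ) * n₂ / (n₁ + n₂) ^ 2 * _).trans_le
    (mul_nonpos_of_nonneg_of_nonpos (by positivity) key)
  field_simp
  ring

theorem expER_add {n M : ℕ} (hn : 1 ≤ n) (f : (Fin M → Fin n × Fin n) → ℝ) (a : ℝ) :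
    expER n M (fun E => f E + a) = expER n M f + a := by
  have : NeZero n := ⟨by omega⟩
  have hcard : ((Fintype.card (Fin M → Fin n × Fin n) : ℕ) : ℝ) ≠ 0 := by
    exact_mod_cast Fintype.card_ne_zero
  unfold expER
  rw [Finset.sum_add_distrib, Finset.sum_const, Finset.card_univ, nsmul_eq_mul]
  field_simp

theorem avgOp_pow_mul_pow_apply {lam : ℝ} (hlam : 0 < lam) {n₁ n₂ : ℕ} (h₁ : 1 ≤ n₁)
    (h₂ : 1 ≤ n₂) (k l : ℕ) :
    (avgOp (Fin.castAdd n₂ : Fin n₁ → Fin (n₁ + n₂)) ^ k *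
      avgOp (Fin.natAdd n₁ : Fin n₂ → Fin (n₁ + n₂)) ^ l)
        (fun A => Real.log (edgeSetZ lam A)) ∅ =
      expER n₁ k (fun E => Real.log (hardCoreZ lam E)) +
        expER n₂ l (fun E => Real.log (hardCoreZ lam E)) := by
  rw [Module.End.mul_apply, avgOp_pow_apply]
  simp only [avgOp_pow_apply, Set.union_empty, Set.range_comp]
  have hlog : ∀ (E₁ : Fin k → Fin n₁ × Fin n₁) (E₂ : Fin l → Fin n₂ × Fin n₂),
      Real.log (edgeSetZ lam (Prod.map (Fin.natAdd n₁) (Fin.natAdd n₁) '' Set.range E₂ ∪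
        Prod.map (Fin.castAdd n₂) (Fin.castAdd n₂) '' Set.range E₁)) =
      Real.log (hardCoreZ lam E₂) + Real.log (hardCoreZ lam E₁) := fun E₁ E₂ => by
    rw [Set.union_comm, edgeSetZ_union_eq_mul, Real.log_mul (edgeSetZ_pos hlam _).ne'
      (edgeSetZ_pos hlam _).ne', hardCoreZ_eq_edgeSetZ, hardCoreZ_eq_edgeSetZ, add_comm]
  simp only [hlog, expER_add h₂]
  rw [← expER_add h₁]
  simp only [add_comm]

end Interpolation

/-- Interpolation inequality for the hard-core log-partition function with `λ > 1`: with
`M₁ ~ Binomial(⌊cN⌋, N₁/N)`, `M₂ = ⌊cN⌋ - M₁`, and conditionally independent Erdős–Rényi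
multigraphs, `E[log Z(G(N,⌊cN⌋))] ≥ E[log Z(G(N₁,M₁))] + E[log Z(G(N₂,M₂))]`. -/
theorem hard_core_logZ_interpolation (c lam : ℝ) (hc : 0 < c) (hlam : 1 < lam)
    (N N₁ N₂ : ℕ) (h₁ : 1 ≤ N₁) (h₁' : N₁ ≤ N - 1) (h₂ : 1 ≤ N₂) (h₂' : N₂ ≤ N - 1)
    (hsum : N₁ + N₂ = N) :
    expER N ⌊c * (N : ℝ)⌋₊ (fun E => Real.log (hardCoreZ lam E)) ≥
      ∑ m ∈ Finset.range (⌊c * (N : ℝ)⌋₊ + 1),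
        binomW ⌊c * (N : ℝ)⌋₊ ((N₁ : ℝ) / (N : ℝ)) m *
          (expER N₁ m (fun E => Real.log (hardCoreZ lam E)) +
            expER N₂ (⌊c * (N : ℝ)⌋₊ - m) (fun E => Real.log (hardCoreZ lam E))) := by
  subst hsum
  have hlam0 : 0 < lam := zero_lt_one.trans hlam
  generalize ⌊c * ((N₁ + N₂ : ℕ) : ℝ)⌋₊ = M
  set θ : ℝ := (N₁ : ℝ) / ((N₁ + N₂ : ℕ) : ℝ) with hθ
  have hθ0 : 0 ≤ θ := by positivity
  have hθ1 : 0 ≤ 1 - θ := by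
    rw [sub_nonneg]
    refine div_le_one_of_le₀ ?_ (by positivity)
    exact_mod_cast Nat.le_add_right N₁ N₂
  set T₁ := avgOp (Fin.castAdd N₂ : Fin N₁ → Fin (N₁ + N₂)) with hT₁
  set T₂ := avgOp (Fin.natAdd N₁ : Fin N₂ → Fin (N₁ + N₂)) with hT₂
  have hmono : Monotone ⇑(θ • T₁ + (1 - θ) • T₂) := fun F G h =>
    add_le_add (smul_le_smul_of_nonneg_left (avgOp_monotone _ h) hθ0)
      (smul_le_smul_of_nonneg_left (avgOp_monotone _ h) hθ1)
  have hcomm : Commute (avgOp (id : Fin (N₁ + N₂) → Fin (N₁ + N₂)))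
      (θ • T₁ + (1 - θ) • T₂) :=
    ((avgOp_commute _ _).smul_right _).add_right ((avgOp_commute _ _).smul_right _)
  have hle := pow_apply_le_pow_apply_of_commute hcomm (avgOp_monotone _) hmono
    (avgOp_split_le hlam0 h₁ h₂) M ∅
  have hsplit : Commute (θ • T₁) ((1 - θ) • T₂) :=
    ((avgOp_commute _ _).smul_left _).smul_right _
  rw [hsplit.add_pow, avgOp_pow_apply] at hle
  simp only [Prod.map_id, Function.id_comp, Set.union_empty, ← hardCoreZ_eq_edgeSetZ] at hle
  refine ge_iff_le.mpr (le_of_eq_of_le ?_ hle)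
  rw [LinearMap.sum_apply, Finset.sum_apply]
  refine Finset.sum_congr rfl fun m _ => ?_
  rw [← avgOp_pow_mul_pow_apply hlam0 h₁ h₂, ← hT₁, ← hT₂, smul_pow, smul_pow, smul_mul_smul_comm,
    ← nsmul_eq_mul', LinearMap.smul_apply, LinearMap.smul_apply, Pi.smul_apply, Pi.smul_apply,
    nsmul_eq_mul, smul_eq_mul, binomW]
  ring
end

section
/- Fix an integer r ≥ 1. There exists a constant C = C(r) such that for every N and every N_1, N_2 ≥ 1 with N_1 + N_2 = N and both N_1 r and N_2 r even, E[I(G(N, r))] ≥ E[I(G(N_1, r))] + E[I(G(N_2, r))] − C N^{5/6}, where G(m, r) denotes the configuration-model random r-regular multigraph on [m] and I(·) denotes the maximum cardinality of an independent set. -/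
open Filter
open scoped Classical

/-- Expectation of `g` when a perfect matching of the `N * r` half-edges is chosen
uniformly at random (the configuration model for the random `r`-regular multigraph). -/
noncomputable def expReg (N r : ℕ) (g : Matching N r → ℝ) : ℝ :=
  (∑ f : Matching N r, g f) / (Fintype.card (Matching N r) : ℝ)

section PairingIndependence

open Equiv Finset

variable {H H' V V' : Type*} [Fintype V] [Fintype V']

/-- `S` is independent in the multigraph obtained by projecting along `p` the pairs
`{h, f h}`, `f h ≠ h`, of a partial matching `f`. -/
def IsIndepFor (p : H → V) (f : Perm H) (S : Finset V) : Prop :=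
  ∀ h, f h ≠ h → ¬(p h ∈ S ∧ p (f h) ∈ S)

/-- The independence number of the projected multigraph of a partial matching. -/
noncomputable def indepNumFor (p : H → V) (f : Perm H) : ℕ :=
  ((univ : Finset (Finset V)).filter (IsIndepFor p f)).sup card

/-- The vertices lying in every maximum independent set. -/
noncomputable def essentialVerts (p : H → V) (f : Perm H) : Finset V :=
  univ.filter fun v => ∀ S, IsIndepFor p f S → S.card = indepNumFor p f → v ∈ S

lemma IsIndepFor.card_le {p : H → V} {f : Perm H} {S : Finset V} (hS : IsIndepFor p f S) :
    S.card ≤ indepNumFor p f :=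
  Finset.le_sup (f := card) (by simpa using hS)

lemma exists_isIndepFor_card_eq (p : H → V) (f : Perm H) :
    ∃ S, IsIndepFor p f S ∧ S.card = indepNumFor p f := by
  obtain ⟨S, hS, h⟩ := Finset.exists_mem_eq_sup
    ((univ : Finset (Finset V)).filter (IsIndepFor p f)) ⟨∅, by simp [IsIndepFor]⟩ card
  exact ⟨S, by simpa using hS, h.symm⟩

lemma indepNumFor_le_card (p : H → V) (f : Perm H) : indepNumFor p f ≤ Fintype.card V :=
  Finset.sup_le fun S _ => Finset.card_le_univ S

lemma indepNumFor_anti (p : H → V) {f g : Perm H} (hfg : ∀ h, f h ≠ h → g h = f h) :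
    indepNumFor p g ≤ indepNumFor p f := by
  obtain ⟨S, hS, hc⟩ := exists_isIndepFor_card_eq p g
  rw [← hc]
  refine IsIndepFor.card_le fun h hh => ?_
  have := hS h
  rw [hfg h hh] at this
  exact this hh

lemma indepNumFor_permCongr (p : H' → V) (e : H ≃ H') (f : Perm H) :
    indepNumFor p (e.permCongr f) = indepNumFor (p ∘ e) f := by
  unfold indepNumFor
  congr 1
  ext S
  simp only [mem_filter, mem_univ, true_and, IsIndepFor]
  rw [← e.forall_congr_right]
  simp

lemma indepNumFor_comp_equiv (p : H → V) (i : V ≃ V') (f : Perm H) :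
    indepNumFor (i ∘ p) f = indepNumFor p f := by
  apply le_antisymm
  · obtain ⟨S, hS, hc⟩ := exists_isIndepFor_card_eq (i ∘ p) f
    rw [← hc, ← Finset.card_map i.symm.toEmbedding]
    refine IsIndepFor.card_le fun h hh => ?_
    simpa [Equiv.symm_apply_eq] using hS h hh
  · obtain ⟨S, hS, hc⟩ := exists_isIndepFor_card_eq p f
    rw [← hc, ← Finset.card_map i.toEmbedding]
    refine IsIndepFor.card_le fun h hh => ?_
    simpa using hS h hh

lemma indepNumFor_sum_le (p : H → V) (p' : H' → V') (f : Perm H) (f' : Perm H') :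
    indepNumFor p f + indepNumFor p' f' ≤
      indepNumFor (Sum.map p p') (Equiv.sumCongr f f') := by
  obtain ⟨S, hS, hc⟩ := exists_isIndepFor_card_eq p f
  obtain ⟨S', hS', hc'⟩ := exists_isIndepFor_card_eq p' f'
  rw [← hc, ← hc', ← Finset.card_disjSum]
  refine IsIndepFor.card_le ?_
  rintro (h | h) hh
  · simpa using hS h (by simpa using hh)
  · simpa using hS' h (by simpa using hh)

section MulSwap

variable [DecidableEq H]

omit [Fintype V] in
lemma isIndepFor_mul_swap {p : H → V} {f : Perm H} {u v : H} (hu : f u = u) (hv : f v = v)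
    (huv : u ≠ v) {S : Finset V} :
    IsIndepFor p (f * swap u v) S ↔ IsIndepFor p f S ∧ ¬(p u ∈ S ∧ p v ∈ S) := by
  constructor
  · intro h
    refine ⟨fun x hx => ?_, ?_⟩
    · have hxu : x ≠ u := by rintro rfl; exact hx hu
      have hxv : x ≠ v := by rintro rfl; exact hx hv
      have := h x
      simp only [Perm.mul_apply, swap_apply_of_ne_of_ne hxu hxv] at this
      exact this hx
    · have := h u
      simp only [Perm.mul_apply, swap_apply_left, hv] at this
      exact this huv.symm
  · rintro ⟨h, h'⟩ x hx
    by_cases hxu : x = u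
    · subst hxu
      simpa [hv] using h'
    by_cases hxv : x = v
    · subst hxv
      simp only [Perm.mul_apply, swap_apply_right, hu]
      tauto
    · simp only [Perm.mul_apply, swap_apply_of_ne_of_ne hxu hxv] at hx ⊢
      exact h x hx

lemma indepNumFor_mul_swap (p : H → V) {f : Perm H} {u v : H} (hu : f u = u) (hv : f v = v)
    (huv : u ≠ v) :
    (indepNumFor p (f * swap u v) : ℝ) = indepNumFor p f -
      if p u ∈ essentialVerts p f ∧ p v ∈ essentialVerts p f then 1 else 0 := by
  have hle : indepNumFor p (f * swap u v) ≤ indepNumFor p f := by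
    obtain ⟨S, hS, hc⟩ := exists_isIndepFor_card_eq p (f * swap u v)
    rw [← hc]
    exact ((isIndepFor_mul_swap hu hv huv).1 hS).1.card_le
  split_ifs with h
  · obtain ⟨hu', hv'⟩ := h
    simp only [essentialVerts, mem_filter, mem_univ, true_and] at hu' hv'
    have h1 : indepNumFor p (f * swap u v) ≠ indepNumFor p f := by
      intro he
      obtain ⟨S, hS, hc⟩ := exists_isIndepFor_card_eq p (f * swap u v)
      obtain ⟨h2, h3⟩ := (isIndepFor_mul_swap hu hv huv).1 hS
      exact h3 ⟨hu' S h2 (hc.trans he), hv' S h2 (hc.trans he)⟩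
    have h2 : indepNumFor p f ≤ indepNumFor p (f * swap u v) + 1 := by
      obtain ⟨S, hS, hc⟩ := exists_isIndepFor_card_eq p f
      have : IsIndepFor p (f * swap u v) (S.erase (p u)) := by
        rw [isIndepFor_mul_swap hu hv huv]
        refine ⟨fun x hx hh => hS x hx ⟨mem_of_mem_erase hh.1, mem_of_mem_erase hh.2⟩, ?_⟩
        simp
      have := this.card_le
      have := Finset.pred_card_le_card_erase (a := p u) (s := S)
      omega
    have h3 : indepNumFor p f = indepNumFor p (f * swap u v) + 1 := by omega
    rw [h3]; push_cast; ring
  · suffices indepNumFor p f ≤ indepNumFor p (f * swap u v) by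
      rw [le_antisymm hle this]; simp
    have : ∃ S, IsIndepFor p f S ∧ S.card = indepNumFor p f ∧ ¬(p u ∈ S ∧ p v ∈ S) := by
      by_contra! hcon
      apply h
      simp only [essentialVerts, mem_filter, mem_univ, true_and]
      exact ⟨fun S h1 h2 => (hcon S h1 h2).1, fun S h1 h2 => (hcon S h1 h2).2⟩
    obtain ⟨S, h1, h2, h3⟩ := this
    rw [← h2]
    exact ((isIndepFor_mul_swap hu hv huv).2 ⟨h1, h3⟩).card_le

lemma sq_div_sub_le {x A : ℝ} (hA : 2 ≤ A) :
    (x / A) ^ 2 - 1 / (4 * (A - 1)) ≤ (x * x - x) / (A * A - A) := by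
  have hA0 : A ≠ 0 := by positivity
  have hA1 : 0 < A - 1 := by linarith
  have h2 : A * A - A ≠ 0 := by nlinarith
  have : (x * x - x) / (A * A - A) - ((x / A) ^ 2 - 1 / (4 * (A - 1))) =
      (A - 2 * x) ^ 2 / (4 * A ^ 2 * (A - 1)) := by
    have : A * A - A = A * (A - 1) := by ring
    rw [this]
    field_simp
    ring
  have h3 : 0 ≤ (A - 2 * x) ^ 2 / (4 * A ^ 2 * (A - 1)) := by positivity
  linarith

lemma sum_product_indepNumFor (p : H → V) {f : Perm H} {A B : Finset H}
    (hA : ∀ u ∈ A, f u = u) (hB : ∀ u ∈ B, f u = u) (hAB : Disjoint A B) :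
    ∑ e ∈ A ×ˢ B, (indepNumFor p (f * swap e.1 e.2) : ℝ) =
      A.card * B.card * indepNumFor p f -
        (A.filter fun u => p u ∈ essentialVerts p f).card *
        (B.filter fun u => p u ∈ essentialVerts p f).card := by
  have : ∀ e ∈ A ×ˢ B, (indepNumFor p (f * swap e.1 e.2) : ℝ) = indepNumFor p f -
      if p e.1 ∈ essentialVerts p f ∧ p e.2 ∈ essentialVerts p f then 1 else 0 := by
    intro e he
    rw [mem_product] at he
    exact indepNumFor_mul_swap p (hA _ he.1) (hB _ he.2)
      (disjoint_iff_ne.1 hAB _ he.1 _ he.2)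
  have hf : ((A ×ˢ B).filter fun e => p e.1 ∈ essentialVerts p f ∧ p e.2 ∈ essentialVerts p f) =
      (A.filter fun u => p u ∈ essentialVerts p f) ×ˢ
        (B.filter fun u => p u ∈ essentialVerts p f) := by
    ext e
    simp only [mem_filter, mem_product]
    tauto
  rw [sum_congr rfl this, sum_sub_distrib, sum_const, ← Finset.natCast_card_filter,
    hf, card_product, card_product, nsmul_eq_mul]
  push_cast
  ring

lemma sum_offDiag_indepNumFor (p : H → V) {f : Perm H} {A : Finset H}
    (hA : ∀ u ∈ A, f u = u) :
    ∑ e ∈ A.offDiag, (indepNumFor p (f * swap e.1 e.2) : ℝ) =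
      (A.card * A.card - A.card) * indepNumFor p f -
        ((A.filter fun u => p u ∈ essentialVerts p f).card *
          (A.filter fun u => p u ∈ essentialVerts p f).card -
          (A.filter fun u => p u ∈ essentialVerts p f).card) := by
  have : ∀ e ∈ A.offDiag, (indepNumFor p (f * swap e.1 e.2) : ℝ) = indepNumFor p f -
      if p e.1 ∈ essentialVerts p f ∧ p e.2 ∈ essentialVerts p f then 1 else 0 := by
    intro e he
    rw [mem_offDiag] at he
    exact indepNumFor_mul_swap p (hA _ he.1) (hA _ he.2.1) he.2.2
  have hf : (A.offDiag.filter fun e => p e.1 ∈ essentialVerts p f ∧ p e.2 ∈ essentialVerts p f) =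
      (A.filter fun u => p u ∈ essentialVerts p f).offDiag := by
    ext e
    simp only [mem_filter, mem_offDiag]
    tauto
  rw [sum_congr rfl this, sum_sub_distrib, sum_const, ← Finset.natCast_card_filter,
    hf, offDiag_card, offDiag_card, Nat.cast_sub (Nat.le_mul_self _), nsmul_eq_mul,
    Nat.cast_sub (Nat.le_mul_self _)]
  push_cast
  ring

/-- Adding a uniform cross pair between two pools of free points costs on average no more, up
to lower order terms, than adding a uniform pair inside a pool chosen by a fair coin. -/
lemma cross_average_ge (p : H → V) {f : Perm H} {A B : Finset H}
    (hA : ∀ u ∈ A, f u = u) (hB : ∀ u ∈ B, f u = u) (hAB : Disjoint A B)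
    (hA2 : 2 ≤ A.card) (hB2 : 2 ≤ B.card) :
    (∑ e ∈ A.offDiag, (indepNumFor p (f * swap e.1 e.2) : ℝ)) / (A.card * A.card - A.card) +
      (∑ e ∈ B.offDiag, (indepNumFor p (f * swap e.1 e.2) : ℝ)) / (B.card * B.card - B.card) -
      (1 / (4 * ((A.card : ℝ) - 1)) + 1 / (4 * ((B.card : ℝ) - 1))) ≤
    2 * ((∑ e ∈ A ×ˢ B, (indepNumFor p (f * swap e.1 e.2) : ℝ)) / (A.card * B.card)) := by
  rw [sum_product_indepNumFor p hA hB hAB, sum_offDiag_indepNumFor p hA,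
    sum_offDiag_indepNumFor p hB]
  have hA' : (2 : ℝ) ≤ A.card := by exact_mod_cast hA2
  have hB' : (2 : ℝ) ≤ B.card := by exact_mod_cast hB2
  generalize (A.card : ℝ) = a at *
  generalize (B.card : ℝ) = b at *
  generalize ((A.filter fun u => p u ∈ essentialVerts p f).card : ℝ) = x
  generalize ((B.filter fun u => p u ∈ essentialVerts p f).card : ℝ) = y
  generalize (indepNumFor p f : ℝ) = j
  have h1 := sq_div_sub_le (x := x) hA'
  have h2 := sq_div_sub_le (x := y) hB'
  have ha : a * a - a ≠ 0 := by nlinarith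
  have hb : b * b - b ≠ 0 := by nlinarith
  have hab : a * b ≠ 0 := by positivity
  rw [sub_div _ (x * x - x), sub_div _ (y * y - y), sub_div _ (x * y),
    mul_div_cancel_left₀ _ ha, mul_div_cancel_left₀ _ hb, mul_div_cancel_left₀ _ hab]
  have h3 : x * y / (a * b) = x / a * (y / b) := by rw [mul_div_mul_comm]
  rw [h3]
  nlinarith [sq_nonneg (x / a - y / b)]


end MulSwap

lemma card_support_of_involution {X : Type*} [Fintype X] {f : Perm X} (hf : ∀ x, f (f x) = x) :
    f.support.card = f.cycleType.card * 2 := by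
  rw [← f.sum_cycleType]
  conv_lhs => rw [Perm.cycleType_of_pow_prime_eq_one (p := 2) (σ := f)
    (by ext y; simp [pow_two, hf])]
  simp

lemma exists_extend_involution {X : Type*} [Fintype X] (hX : Even (Fintype.card X)) (f : Perm X)
    (hf : ∀ x, f (f x) = x) :
    ∃ g : Perm X, (∀ x, g (g x) = x) ∧ (∀ x, g x ≠ x) ∧ ∀ x, f x ≠ x → g x = f x := by
  induction hn : (univ.filter fun x => f x = x).card using Nat.strong_induction_on generalizing f with
  | _ n ih =>
  by_cases hfix : ∃ x, f x = x
  · obtain ⟨x, hx⟩ := hfix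
    have hpar : Even n := by
      have h1 : (univ.filter fun x => f x = x) = f.supportᶜ := by ext; simp
      have h2 := f.support.card_le_univ
      rw [← hn, h1, card_compl, Nat.even_sub h2, card_support_of_involution hf]
      simp [hX]
    have h2 : 1 < (univ.filter fun x => f x = x).card := by
      have : 0 < (univ.filter fun x => f x = x).card := card_pos.2 ⟨x, by simpa using hx⟩
      rw [hn] at this ⊢
      obtain ⟨k, rfl⟩ := hpar
      omega
    obtain ⟨y, hy, hyx⟩ := exists_mem_ne h2 x
    replace hy : f y = y := by simpa using hy
    have hval : ∀ z, z ≠ x → z ≠ y → (f * swap x y) z = f z := fun z hzx hzy => by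
      rw [Perm.mul_apply, swap_apply_of_ne_of_ne hzx hzy]
    have hvx : (f * swap x y) x = y := by simp [hy]
    have hvy : (f * swap x y) y = x := by simp [hx]
    have hinv : ∀ z, (f * swap x y) ((f * swap x y) z) = z := by
      intro z
      by_cases hzx : z = x
      · rw [hzx, hvx, hvy]
      by_cases hzy : z = y
      · rw [hzy, hvy, hvx]
      rw [hval z hzx hzy, hval, hf]
      · intro h; apply hzx; rw [← hf z, h, hx]
      · intro h; apply hzy; rw [← hf z, h, hy]
    obtain ⟨g, hg1, hg2, hg3⟩ := ih _ (by
      rw [← hn]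
      apply card_lt_card
      rw [ssubset_iff_of_subset]
      · exact ⟨x, by simpa using hx, fun h => hyx (hvx.symm.trans (Finset.mem_filter.1 h).2)⟩
      · intro z hz
        simp only [mem_filter, mem_univ, true_and] at hz ⊢
        by_cases hzx : z = x
        · rw [hzx, hx]
        by_cases hzy : z = y
        · rw [hzy, hy]
        rwa [hval z hzx hzy] at hz) (f * swap x y) hinv rfl
    refine ⟨g, hg1, hg2, fun z hz => ?_⟩
    have h3 : z ≠ x := by rintro rfl; exact hz hx
    have h4 : z ≠ y := by rintro rfl; exact hz hy
    rw [hg3 z (by rwa [hval z h3 h4]), hval z h3 h4]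
  · push Not at hfix
    exact ⟨f, hf, hfix, fun _ _ => rfl⟩

lemma exists_permCongr_eq_of_involution {X : Type*} [Fintype X] {f g : Perm X}
    (hf : ∀ x, f (f x) = x) (hg : ∀ x, g (g x) = x) (hf' : ∀ x, f x ≠ x) (hg' : ∀ x, g x ≠ x) :
    ∃ γ : Perm X, γ.permCongr g = f := by
  have key : ∀ k : Perm X, (∀ x, k (k x) = x) → (∀ x, k x ≠ x) →
      k.cycleType = Multiset.replicate (Fintype.card X / 2) 2 := by
    intro k hk hk'
    have hsupp : k.support = univ := by ext x; simp [hk' x]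
    have := card_support_of_involution hk
    rw [hsupp, card_univ] at this
    rw [this, Nat.mul_div_cancel _ (by norm_num)]
    exact Perm.cycleType_of_pow_prime_eq_one (by ext y; simp [pow_two, hk])
  have hconj : IsConj g f := Perm.isConj_iff_cycleType_eq.2 (by rw [key g hg hg', key f hf hf'])
  obtain ⟨γ, hγ⟩ := isConj_iff.1 hconj
  exact ⟨γ, by rw [← hγ]; ext x; simp⟩

/-- The independence number of the partial matching `f` of `H ⊕ H'`, averaged over relabellings
of the two summands. -/
noncomputable def symAvg [Fintype H] [Fintype H'] (p : H ⊕ H' → V) (f : Perm (H ⊕ H')) : ℝ :=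
  (∑ γ : Perm H × Perm H', (indepNumFor (p ∘ Sum.map γ.1 γ.2) f : ℝ)) /
    (Fintype.card (Perm H × Perm H') : ℝ)

section symAvg

variable [Fintype H] [Fintype H'] (p : H ⊕ H' → V)

lemma card_perm_prod_pos : (0 : ℝ) < Fintype.card (Perm H × Perm H') := by
  exact_mod_cast Fintype.card_pos

lemma symAvg_nonneg (f : Perm (H ⊕ H')) : 0 ≤ symAvg p f := by
  unfold symAvg; positivity

lemma symAvg_le_card (f : Perm (H ⊕ H')) : symAvg p f ≤ Fintype.card V := by
  unfold symAvg
  rw [div_le_iff₀ card_perm_prod_pos]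
  calc _ ≤ ∑ γ : Perm H × Perm H', (Fintype.card V : ℝ) :=
        sum_le_sum fun γ _ => by exact_mod_cast indepNumFor_le_card _ f
    _ = _ := by rw [sum_const, card_univ, nsmul_eq_mul, mul_comm]

lemma symAvg_anti {f g : Perm (H ⊕ H')} (hfg : ∀ h, f h ≠ h → g h = f h) :
    symAvg p g ≤ symAvg p f := by
  unfold symAvg
  gcongr with γ
  exact indepNumFor_anti _ hfg

lemma le_sum_symAvg_of_forall {ι : Type*} [Fintype ι] (F : ι → Perm (H ⊕ H')) {c : ℝ}
    (h : ∀ γ : Perm H × Perm H', c ≤ ∑ i, (indepNumFor (p ∘ Sum.map γ.1 γ.2) (F i) : ℝ)) :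
    c ≤ ∑ i, symAvg p (F i) := by
  unfold symAvg
  rw [← sum_div, sum_comm, le_div_iff₀ card_perm_prod_pos, mul_comm, ← nsmul_eq_mul, ← card_univ]
  exact card_nsmul_le_sum _ _ _ fun γ _ => h γ

lemma sum_symAvg_le_of_forall {ι : Type*} [Fintype ι] (F : ι → Perm (H ⊕ H')) {c : ℝ}
    (h : ∀ γ : Perm H × Perm H', ∑ i, (indepNumFor (p ∘ Sum.map γ.1 γ.2) (F i) : ℝ) ≤ c) :
    ∑ i, symAvg p (F i) ≤ c := by
  unfold symAvg
  rw [← sum_div, sum_comm, div_le_iff₀ card_perm_prod_pos, mul_comm, ← nsmul_eq_mul, ← card_univ]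
  exact sum_le_card_nsmul _ _ _ fun γ _ => h γ

lemma symAvg_permCongr (δ : Perm H × Perm H') (f : Perm (H ⊕ H')) :
    symAvg p ((Equiv.sumCongr δ.1 δ.2).permCongr f) = symAvg p f := by
  unfold symAvg
  congr 1
  rw [← Equiv.sum_comp (Equiv.mulRight δ) fun γ : Perm H × Perm H' =>
    (indepNumFor (p ∘ Sum.map γ.1 γ.2) f : ℝ)]
  refine sum_congr rfl fun γ _ => ?_
  rw [indepNumFor_permCongr]
  congr 2
  ext x
  rcases x with x | x <;> simp

lemma symAvg_sub_one_le {f : Perm (H ⊕ H')} {u v : H ⊕ H'} (hu : f u = u) (hv : f v = v)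
    (huv : u ≠ v) : symAvg p f - 1 ≤ symAvg p (f * swap u v) := by
  unfold symAvg
  rw [le_div_iff₀ card_perm_prod_pos, sub_mul, div_mul_cancel₀ _ card_perm_prod_pos.ne', one_mul,
    sub_le_iff_le_add]
  calc _ ≤ ∑ γ : Perm H × Perm H', ((indepNumFor (p ∘ Sum.map γ.1 γ.2) (f * swap u v) : ℝ) + 1) :=
        sum_le_sum fun γ _ => by
          rw [indepNumFor_mul_swap _ hu hv huv]
          split_ifs <;> linarith
    _ = _ := by rw [sum_add_distrib, sum_const, card_univ, nsmul_eq_mul, mul_one]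

/-- The elements of `H` left free by `f`. -/
noncomputable def freeLeft (f : Perm (H ⊕ H')) : Finset H :=
  univ.filter fun h => f (Sum.inl h) = Sum.inl h

/-- The elements of `H'` left free by `f`. -/
noncomputable def freeRight (f : Perm (H ⊕ H')) : Finset H' :=
  univ.filter fun h => f (Sum.inr h) = Sum.inr h

/-- The elements of `H` matched by `f` to an element of `H'`. -/
noncomputable def crossLeft (f : Perm (H ⊕ H')) : Finset H :=
  univ.filter fun h => (f (Sum.inl h)).isRight

lemma permCongr_eq_self {α : Type*} (γ : α ≃ α) (f : Perm α) (h : ∀ x, γ (f x) = f (γ x)) :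
    γ.permCongr f = f := by
  ext x
  simp [h]

lemma symAvg_mul_swap_cross {f : Perm (H ⊕ H')} {u v : H} {u' v' : H'}
    (hu : u ∈ freeLeft f) (hv : v ∈ freeLeft f) (hu' : u' ∈ freeRight f) (hv' : v' ∈ freeRight f) :
    symAvg p (f * swap (Sum.inl u) (Sum.inr u')) = symAvg p (f * swap (Sum.inl v) (Sum.inr v')) := by
  simp only [freeLeft, freeRight, mem_filter, mem_univ, true_and] at hu hv hu' hv'
  rw [← symAvg_permCongr p (swap u v, swap u' v')]
  congr 1
  have key : ∀ x, Equiv.sumCongr (swap u v) (swap u' v') (f x) =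
      f (Equiv.sumCongr (swap u v) (swap u' v') x) := by
    have : (Equiv.sumCongr (swap u v) (swap u' v')) =
      swap (Sum.inl u) (Sum.inl v) * swap (Sum.inr u') (Sum.inr v') := by
      rw [← Perm.sumCongr_swap_one, ← Perm.sumCongr_one_swap, Perm.sumCongr_mul, mul_one, one_mul]
    rw [this]
    intro x
    rw [← Perm.mul_apply, ← Perm.mul_apply]
    refine congrArg (fun g : Perm (H ⊕ H') => g x) ?_
    rw [mul_assoc, ← mul_assoc f, Equiv.mul_swap_eq_swap_mul f (Sum.inl u), hu, hv, mul_assoc,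
      Equiv.mul_swap_eq_swap_mul f, hu', hv']
  have h1 : ∀ γ : Perm (H ⊕ H'), ∀ a b : Perm (H ⊕ H'), γ.permCongr (a * b) =
      γ.permCongr a * γ.permCongr b := by
    intro γ a b; ext x; simp
  rw [h1, permCongr_eq_self _ f key]
  refine congrArg (f * ·) ((symm_trans_swap_trans _ _ _).trans ?_)
  simp

/-- A lower bound for the average after adding one pair inside either summand yields a lower
bound for the average after adding one cross pair. -/
lemma symAvg_cross_ge {f : Perm (H ⊕ H')} {u : H} {u' : H'} {X Y : ℝ}
    (hu : u ∈ freeLeft f) (hu' : u' ∈ freeRight f)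
    (hA : 2 ≤ (freeLeft f).card) (hB : 2 ≤ (freeRight f).card)
    (hX : ∀ v ∈ freeLeft f, ∀ w ∈ freeLeft f, v ≠ w →
      X ≤ symAvg p (f * swap (Sum.inl v) (Sum.inl w)))
    (hY : ∀ v ∈ freeRight f, ∀ w ∈ freeRight f, v ≠ w →
      Y ≤ symAvg p (f * swap (Sum.inr v) (Sum.inr w))) :
    X + Y - (1 / (4 * (((freeLeft f).card : ℝ) - 1)) + 1 / (4 * (((freeRight f).card : ℝ) - 1))) ≤
      2 * symAvg p (f * swap (Sum.inl u) (Sum.inr u')) := by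
  set A : Finset (H ⊕ H') := (freeLeft f).map Function.Embedding.inl with hAdef
  set B : Finset (H ⊕ H') := (freeRight f).map Function.Embedding.inr with hBdef
  have hAc : A.card = (freeLeft f).card := card_map _
  have hBc : B.card = (freeRight f).card := card_map _
  rw [← hAc] at hA ⊢
  rw [← hBc] at hB ⊢
  have hAf : ∀ x ∈ A, f x = x := by simp [A, freeLeft]
  have hBf : ∀ x ∈ B, f x = x := by simp [B, freeRight]
  have hAB : Disjoint A B := by
    rw [disjoint_left]
    simp [A, B]
  set K : ℝ := (Fintype.card (Perm H × Perm H') : ℝ) with hK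
  have hK0 : 0 < K := card_perm_prod_pos
  have swapSum : ∀ E : Finset ((H ⊕ H') × (H ⊕ H')),
      ∑ e ∈ E, symAvg p (f * swap e.1 e.2) = (∑ γ : Perm H × Perm H',
        ∑ e ∈ E, (indepNumFor (p ∘ Sum.map γ.1 γ.2) (f * swap e.1 e.2) : ℝ)) / K := by
    intro E
    unfold symAvg
    rw [← sum_div, sum_comm]
  have ha : (2 : ℝ) ≤ A.card := by exact_mod_cast hA
  have hb : (2 : ℝ) ≤ B.card := by exact_mod_cast hB
  have ha' : (0 : ℝ) < A.card * A.card - A.card := by nlinarith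
  have hb' : (0 : ℝ) < B.card * B.card - B.card := by nlinarith
  have hX' : X ≤ (∑ e ∈ A.offDiag, symAvg p (f * swap e.1 e.2)) / (A.card * A.card - A.card) := by
    rw [le_div_iff₀ ha']
    calc X * (A.card * A.card - A.card) = ∑ e ∈ A.offDiag, X := by
          rw [sum_const, offDiag_card, nsmul_eq_mul, Nat.cast_sub (Nat.le_mul_self _)]
          push_cast; ring
      _ ≤ _ := by
          refine sum_le_sum ?_
          rintro ⟨x, y⟩ he
          simp only [mem_offDiag, A, Finset.mem_map, Function.Embedding.inl_apply] at he
          obtain ⟨⟨v, hv, rfl⟩, ⟨w, hw, rfl⟩, hne⟩ := he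
          exact hX v hv w hw (by rintro rfl; exact hne rfl)
  have hY' : Y ≤ (∑ e ∈ B.offDiag, symAvg p (f * swap e.1 e.2)) / (B.card * B.card - B.card) := by
    rw [le_div_iff₀ hb']
    calc Y * (B.card * B.card - B.card) = ∑ e ∈ B.offDiag, Y := by
          rw [sum_const, offDiag_card, nsmul_eq_mul, Nat.cast_sub (Nat.le_mul_self _)]
          push_cast; ring
      _ ≤ _ := by
          refine sum_le_sum ?_
          rintro ⟨x, y⟩ he
          simp only [mem_offDiag, B, Finset.mem_map, Function.Embedding.inr_apply] at he
          obtain ⟨⟨v, hv, rfl⟩, ⟨w, hw, rfl⟩, hne⟩ := he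
          exact hY v hv w hw (by rintro rfl; exact hne rfl)
  have hZ : symAvg p (f * swap (Sum.inl u) (Sum.inr u')) =
      (∑ e ∈ A ×ˢ B, symAvg p (f * swap e.1 e.2)) / (A.card * B.card) := by
    rw [eq_div_iff (by positivity)]
    calc _ = ∑ e ∈ A ×ˢ B, symAvg p (f * swap (Sum.inl u) (Sum.inr u')) := by
          rw [sum_const, card_product, nsmul_eq_mul]; push_cast; ring
      _ = _ := by
          refine sum_congr rfl ?_
          rintro ⟨x, y⟩ he
          simp only [mem_product, A, B, Finset.mem_map, Function.Embedding.inl_apply,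
            Function.Embedding.inr_apply] at he
          obtain ⟨⟨v, hv, rfl⟩, ⟨w, hw, rfl⟩⟩ := he
          exact symAvg_mul_swap_cross p hu hv hu' hw
  have hsum := sum_le_sum fun (γ : Perm H × Perm H') (_ : γ ∈ univ) =>
    cross_average_ge (p ∘ Sum.map γ.1 γ.2) hAf hBf hAB hA hB
  rw [sum_sub_distrib, sum_add_distrib, sum_const, card_univ, nsmul_eq_mul, ← hK, ← sum_div,
    ← sum_div, ← mul_sum, ← sum_div] at hsum
  rw [swapSum] at hX' hY' hZ
  rw [hZ]
  have hsum' := div_le_div_of_nonneg_right hsum hK0.le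
  rw [sub_div, add_div, mul_div_cancel_left₀ _ hK0.ne'] at hsum'
  rw [div_right_comm] at hX' hY' ⊢
  rw [mul_div_assoc] at hsum'
  linarith


lemma mul_swap_involution {α : Type*} [DecidableEq α] {f : Perm α} {x y : α}
    (hf : ∀ z, f (f z) = z) (h : swap (f x) (f y) = swap x y) (z : α) :
    (f * swap x y) ((f * swap x y) z) = z := by
  have h1 : (f * swap x y) * (f * swap x y) = 1 := by
    conv_lhs => rw [mul_assoc, Equiv.mul_swap_eq_swap_mul f x y, h]
    rw [← mul_assoc (swap x y), swap_mul_self, one_mul]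
    ext z; simp [hf]
  rw [← Perm.mul_apply, h1, Perm.one_apply]

lemma mul_swap_apply_s13 {α : Type*} [DecidableEq α] (f : Perm α) (x y z : α) :
    (f * swap x y) z = if z = x then f y else if z = y then f x else f z := by
  rw [Perm.mul_apply, swap_apply_def]
  split_ifs <;> rfl

omit [Fintype H'] in
lemma card_freeLeft_remove {f : Perm (H ⊕ H')} (hf : ∀ z, f (f z) = z) {u : H} {u' : H'}
    (h : f (Sum.inl u) = Sum.inr u') :
    (freeLeft (f * swap (Sum.inl u) (Sum.inr u'))).card = (freeLeft f).card + 1 := by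
  have h' : f (Sum.inr u') = Sum.inl u := by rw [← h, hf]
  rw [← card_insert_of_notMem (a := u) (s := freeLeft f) (by simp [freeLeft, h])]
  congr 1
  ext z
  by_cases hz : z = u <;> simp [freeLeft, mul_swap_apply_s13, hz, h', -Perm.coe_mul]

omit [Fintype H] in
lemma card_freeRight_remove {f : Perm (H ⊕ H')} (hf : ∀ z, f (f z) = z) {u : H} {u' : H'}
    (h : f (Sum.inl u) = Sum.inr u') :
    (freeRight (f * swap (Sum.inl u) (Sum.inr u'))).card = (freeRight f).card + 1 := by
  have h' : f (Sum.inr u') = Sum.inl u := by rw [← h, hf]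
  rw [← card_insert_of_notMem (a := u') (s := freeRight f) (by simp [freeRight, h'])]
  congr 1
  ext z
  by_cases hz : z = u' <;> simp [freeRight, mul_swap_apply_s13, hz, h, -Perm.coe_mul]

omit [Fintype H'] in
lemma card_crossLeft_remove {f : Perm (H ⊕ H')} (hf : ∀ z, f (f z) = z) {u : H} {u' : H'}
    (h : f (Sum.inl u) = Sum.inr u') :
    (crossLeft (f * swap (Sum.inl u) (Sum.inr u'))).card + 1 = (crossLeft f).card := by
  have h' : f (Sum.inr u') = Sum.inl u := by rw [← h, hf]
  rw [← card_erase_add_one (a := u) (s := crossLeft f) (by simp [crossLeft, h])]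
  congr 2
  ext z
  by_cases hz : z = u <;> simp [crossLeft, mul_swap_apply_s13, hz, h', -Perm.coe_mul]

omit [Fintype H'] in
lemma card_freeLeft_add_left {f : Perm (H ⊕ H')} {v w : H} (hv : v ∈ freeLeft f)
    (hw : w ∈ freeLeft f) (hvw : v ≠ w) :
    (freeLeft (f * swap (Sum.inl v) (Sum.inl w))).card + 2 = (freeLeft f).card := by
  rw [← card_erase_add_one hv, ← card_erase_add_one (mem_erase.2 ⟨hvw.symm, hw⟩), add_assoc]
  congr 2
  simp only [freeLeft, mem_filter, mem_univ, true_and] at hv hw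
  ext z
  by_cases hz : z = v
  · simp [freeLeft, mul_swap_apply_s13, hz, hw, hvw.symm, -Perm.coe_mul]
  by_cases hz' : z = w
  · simp [freeLeft, mul_swap_apply_s13, hz', hv, hvw, hvw.symm, -Perm.coe_mul]
  · simp [freeLeft, mul_swap_apply_s13, hz, hz', -Perm.coe_mul]

omit [Fintype H] in
lemma card_freeRight_add_right {f : Perm (H ⊕ H')} {v w : H'} (hv : v ∈ freeRight f)
    (hw : w ∈ freeRight f) (hvw : v ≠ w) :
    (freeRight (f * swap (Sum.inr v) (Sum.inr w))).card + 2 = (freeRight f).card := by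
  rw [← card_erase_add_one hv, ← card_erase_add_one (mem_erase.2 ⟨hvw.symm, hw⟩), add_assoc]
  congr 2
  simp only [freeRight, mem_filter, mem_univ, true_and] at hv hw
  ext z
  by_cases hz : z = v
  · simp [freeRight, mul_swap_apply_s13, hz, hw, hvw.symm, -Perm.coe_mul]
  by_cases hz' : z = w
  · simp [freeRight, mul_swap_apply_s13, hz', hv, hvw, hvw.symm, -Perm.coe_mul]
  · simp [freeRight, mul_swap_apply_s13, hz, hz', -Perm.coe_mul]

omit [Fintype H] in
lemma freeRight_add_left (f : Perm (H ⊕ H')) (v w : H) :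
    freeRight (f * swap (Sum.inl v) (Sum.inl w)) = freeRight f := by
  ext z
  simp [freeRight, mul_swap_apply_s13, -Perm.coe_mul]

omit [Fintype H'] in
lemma freeLeft_add_right (f : Perm (H ⊕ H')) (v w : H') :
    freeLeft (f * swap (Sum.inr v) (Sum.inr w)) = freeLeft f := by
  ext z
  simp [freeLeft, mul_swap_apply_s13, -Perm.coe_mul]

omit [Fintype H'] in
lemma crossLeft_add_left {f : Perm (H ⊕ H')} {v w : H} (hv : v ∈ freeLeft f)
    (hw : w ∈ freeLeft f) :
    crossLeft (f * swap (Sum.inl v) (Sum.inl w)) = crossLeft f := by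
  simp only [freeLeft, mem_filter, mem_univ, true_and] at hv hw
  ext z
  by_cases hz : z = v
  · simp [crossLeft, mul_swap_apply_s13, hz, hw, hv, -Perm.coe_mul]
  by_cases hz' : z = w
  · simp [crossLeft, mul_swap_apply_s13, hz', hv, hw, hz' ▸ hz, -Perm.coe_mul]
  · simp [crossLeft, mul_swap_apply_s13, hz, hz', -Perm.coe_mul]

omit [Fintype H'] in
lemma crossLeft_add_right (f : Perm (H ⊕ H')) (v w : H') :
    crossLeft (f * swap (Sum.inr v) (Sum.inr w)) = crossLeft f := by
  ext z
  simp [crossLeft, mul_swap_apply_s13, -Perm.coe_mul]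

/-- A partial matching without cross pairs has average at least that of any perfect matching
without cross pairs. -/
lemma symAvg_ge_of_crossLeft_eq_empty (hH : Even (Fintype.card H)) (hH' : Even (Fintype.card H'))
    {g : Perm H} {g' : Perm H'} (hg : ∀ x, g (g x) = x) (hgx : ∀ x, g x ≠ x)
    (hg' : ∀ x, g' (g' x) = x) (hgx' : ∀ x, g' x ≠ x)
    {f : Perm (H ⊕ H')} (hf : ∀ z, f (f z) = z) (hc : crossLeft f = ∅) :
    symAvg p (Equiv.sumCongr g g') ≤ symAvg p f := by
  have hmaps : Set.MapsTo f (Set.range Sum.inl) (Set.range Sum.inl) := by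
    rintro _ ⟨h, rfl⟩
    have : h ∉ crossLeft f := by simp [hc]
    simp only [crossLeft, mem_filter, mem_univ, true_and] at this
    rcases hx : f (Sum.inl h) with y | y
    · exact ⟨y, rfl⟩
    · simp [hx] at this
  obtain ⟨⟨k, k'⟩, hk⟩ := Perm.mem_sumCongrHom_range_of_perm_mapsTo_inl hmaps
  replace hk : Equiv.sumCongr k k' = f := hk
  subst hk
  obtain ⟨l, hl1, hl2, hl3⟩ := exists_extend_involution hH k fun x => by
    simpa using hf (Sum.inl x)
  obtain ⟨l', hl1', hl2', hl3'⟩ := exists_extend_involution hH' k' fun x => by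
    simpa using hf (Sum.inr x)
  obtain ⟨γ, hγ⟩ := exists_permCongr_eq_of_involution hl1 hg hl2 hgx
  obtain ⟨γ', hγ'⟩ := exists_permCongr_eq_of_involution hl1' hg' hl2' hgx'
  calc symAvg p (Equiv.sumCongr g g') = symAvg p (Equiv.sumCongr l l') := by
        rw [← symAvg_permCongr p (γ, γ') (Equiv.sumCongr g g'), ← hγ, ← hγ']
        congr 1
        ext x
        rcases x with x | x <;> simp
    _ ≤ _ := by
        apply symAvg_anti
        rintro (x | x) hx
        · simpa using hl3 x (by simpa using hx)
        · simpa using hl3' x (by simpa using hx)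

/-- Replacing the cross pairs one at a time by inside pairs: a lower bound for the average of a
partial matching in terms of its number of cross pairs and the imbalance of its free pools. -/
lemma symAvg_ge_potential {G : ℝ} {L : ℕ} (hL : 1 ≤ L) (hGV : G ≤ Fintype.card V)
    (hG : ∀ f : Perm (H ⊕ H'), (∀ z, f (f z) = z) → crossLeft f = ∅ → G ≤ symAvg p f)
    (c : ℕ) (f : Perm (H ⊕ H')) (hf : ∀ z, f (f z) = z) (hc : (crossLeft f).card = c)
    (hAB : (freeLeft f).card + (freeRight f).card = 4 * L) :
    G - c * (Fintype.card V / (L : ℝ) ^ 2 + 1 / (4 * L)) -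
      (((freeLeft f).card : ℝ) - (freeRight f).card) ^ 2 * (Fintype.card V / (4 * (L : ℝ) ^ 2)) ≤
      symAvg p f := by
  have hL' : (1 : ℝ) ≤ L := by exact_mod_cast hL
  induction c generalizing f with
  | zero =>
    refine le_trans ?_ (hG f hf (card_eq_zero.1 hc))
    have : 0 ≤ (((freeLeft f).card : ℝ) - (freeRight f).card) ^ 2 *
      (Fintype.card V / (4 * (L : ℝ) ^ 2)) := by positivity
    simp only [Nat.cast_zero, zero_mul, sub_zero]
    linarith
  | succ c ih =>
    by_cases hsmall : (freeLeft f).card < L ∨ (freeRight f).card < L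
    · refine le_trans ?_ (symAvg_nonneg p f)
      have h1 : (4 * (L : ℝ) ^ 2) ≤ (((freeLeft f).card : ℝ) - (freeRight f).card) ^ 2 := by
        have hAB' : ((freeLeft f).card : ℝ) + (freeRight f).card = 4 * L := by exact_mod_cast hAB
        rcases hsmall with h | h
        · have h' : ((freeLeft f).card : ℝ) ≤ L := by exact_mod_cast h.le
          nlinarith
        · have h' : ((freeRight f).card : ℝ) ≤ L := by exact_mod_cast h.le
          nlinarith
      have h2 : (Fintype.card V : ℝ) ≤ (((freeLeft f).card : ℝ) - (freeRight f).card) ^ 2 *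
          (Fintype.card V / (4 * (L : ℝ) ^ 2)) := by
        calc (Fintype.card V : ℝ) = 4 * (L : ℝ) ^ 2 * (Fintype.card V / (4 * (L : ℝ) ^ 2)) := by
              field_simp
          _ ≤ _ := by gcongr
      have h3 : 0 ≤ ((c + 1 : ℕ) : ℝ) * (Fintype.card V / (L : ℝ) ^ 2 + 1 / (4 * L)) := by positivity
      linarith
    push Not at hsmall
    obtain ⟨hA, hB⟩ := hsmall
    obtain ⟨u, hu⟩ : (crossLeft f).Nonempty := card_pos.1 (by omega)
    simp only [crossLeft, mem_filter, mem_univ, true_and, Sum.isRight_iff] at hu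
    obtain ⟨u', hu⟩ := hu
    have hu' : f (Sum.inr u') = Sum.inl u := by rw [← hu, hf]
    have hA1 := card_freeLeft_remove hf hu
    have hB1 := card_freeRight_remove hf hu
    have hc1 := card_crossLeft_remove hf hu
    have hinv := mul_swap_involution (x := Sum.inl u) (y := Sum.inr u') hf
      (by rw [hu, hu', swap_comm])
    have hback : (f * swap (Sum.inl u) (Sum.inr u')) * swap (Sum.inl u) (Sum.inr u') = f := by
      rw [mul_assoc, swap_mul_self, mul_one]
    have hul : u ∈ freeLeft (f * swap (Sum.inl u) (Sum.inr u')) := by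
      simp [freeLeft, mul_swap_apply_s13, hu', -Perm.coe_mul]
    have hur : u' ∈ freeRight (f * swap (Sum.inl u) (Sum.inr u')) := by
      simp [freeRight, mul_swap_apply_s13, hu, -Perm.coe_mul]
    generalize f * swap (Sum.inl u) (Sum.inr u') = k at *
    have key := symAvg_cross_ge p hul hur (by omega) (by omega)
      (X := G - c * (Fintype.card V / (L : ℝ) ^ 2 + 1 / (4 * L)) -
        (((freeLeft f).card : ℝ) - (freeRight f).card - 2) ^ 2 *
          (Fintype.card V / (4 * (L : ℝ) ^ 2)))
      (Y := G - c * (Fintype.card V / (L : ℝ) ^ 2 + 1 / (4 * L)) -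
        (((freeLeft f).card : ℝ) - (freeRight f).card + 2) ^ 2 *
          (Fintype.card V / (4 * (L : ℝ) ^ 2)))
      (by
        intro v hv w hw hvw
        have h1 := card_freeLeft_add_left hv hw hvw
        have h2 := freeRight_add_left k v w
        have h3 := crossLeft_add_left hv hw
        have hv' : k (Sum.inl v) = Sum.inl v := by simpa [freeLeft] using hv
        have hw' : k (Sum.inl w) = Sum.inl w := by simpa [freeLeft] using hw
        have h4 := ih (k * swap (Sum.inl v) (Sum.inl w))
          (mul_swap_involution hinv (by rw [hv', hw'])) (by rw [h3]; omega) (by rw [h2]; omega)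
        rw [h2, hB1] at h4
        have h5 : ((freeLeft (k * swap (Sum.inl v) (Sum.inl w))).card : ℝ) =
            (freeLeft f).card - 1 := by
          rw [eq_sub_iff_add_eq]; norm_cast; omega
        rw [h5] at h4
        convert h4 using 4
        push_cast; ring)
      (by
        intro v hv w hw hvw
        have h1 := card_freeRight_add_right hv hw hvw
        have h2 := freeLeft_add_right k v w
        have h3 := crossLeft_add_right k v w
        have hv' : k (Sum.inr v) = Sum.inr v := by simpa [freeRight] using hv
        have hw' : k (Sum.inr w) = Sum.inr w := by simpa [freeRight] using hw
        have h4 := ih (k * swap (Sum.inr v) (Sum.inr w))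
          (mul_swap_involution hinv (by rw [hv', hw'])) (by rw [h3]; omega) (by rw [h2]; omega)
        rw [h2, hA1] at h4
        have h5 : ((freeRight (k * swap (Sum.inr v) (Sum.inr w))).card : ℝ) =
            (freeRight f).card - 1 := by
          rw [eq_sub_iff_add_eq]; norm_cast; omega
        rw [h5] at h4
        convert h4 using 4
        push_cast; ring)
    rw [hback, hA1, hB1] at key
    have hA' : (L : ℝ) ≤ (freeLeft f).card := by exact_mod_cast hA
    have hB' : (L : ℝ) ≤ (freeRight f).card := by exact_mod_cast hB
    have e1 : 1 / (4 * ((((freeLeft f).card + 1 : ℕ) : ℝ) - 1)) ≤ 1 / (4 * (L : ℝ)) := by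
      push_cast
      rw [add_sub_cancel_right]
      gcongr
    have e2 : 1 / (4 * ((((freeRight f).card + 1 : ℕ) : ℝ) - 1)) ≤ 1 / (4 * (L : ℝ)) := by
      push_cast
      rw [add_sub_cancel_right]
      gcongr
    have e3 : (Fintype.card V : ℝ) / (L : ℝ) ^ 2 = 4 * (Fintype.card V / (4 * (L : ℝ) ^ 2)) := by
      field_simp
    rw [e3] at key ⊢
    push_cast at key e1 e2 ⊢
    nlinarith

/-- Removing `k` cross pairs. -/
lemma exists_remove_cross {f : Perm (H ⊕ H')} (hf : ∀ z, f (f z) = z) {k : ℕ}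
    (hk : k ≤ (crossLeft f).card) :
    ∃ f' : Perm (H ⊕ H'), (∀ z, f' (f' z) = z) ∧ (crossLeft f').card + k = (crossLeft f).card ∧
      (freeLeft f').card = (freeLeft f).card + k ∧ (freeRight f').card = (freeRight f).card + k ∧
      symAvg p f' - k ≤ symAvg p f := by
  induction k with
  | zero => exact ⟨f, hf, rfl, rfl, rfl, by simp⟩
  | succ k ih =>
    obtain ⟨k', hinv, h1, h2, h3, h4⟩ := ih (by omega)
    obtain ⟨u, hu⟩ : (crossLeft k').Nonempty := card_pos.1 (by omega)
    simp only [crossLeft, mem_filter, mem_univ, true_and, Sum.isRight_iff] at hu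
    obtain ⟨u', hu⟩ := hu
    have hu' : k' (Sum.inr u') = Sum.inl u := by rw [← hu, hinv]
    have hA1 := card_freeLeft_remove hinv hu
    have hB1 := card_freeRight_remove hinv hu
    have hc1 := card_crossLeft_remove hinv hu
    refine ⟨k' * swap (Sum.inl u) (Sum.inr u'), mul_swap_involution hinv
      (by rw [hu, hu', swap_comm]), by omega, by omega, by omega, ?_⟩
    have h5 := symAvg_sub_one_le p (f := k' * swap (Sum.inl u) (Sum.inr u'))
      (u := Sum.inl u) (v := Sum.inr u') (by simp [hu']) (by simp [hu]) (by simp)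
    rw [mul_assoc, swap_mul_self, mul_one] at h5
    push_cast
    linarith

/-- The average of any perfect matching is at least that of a perfect matching without cross
pairs, up to an error controlled by `L`. -/
lemma symAvg_ge_of_perfect {L : ℕ} (hL : 1 ≤ L)
    (hH : Even (Fintype.card H)) (hH' : Even (Fintype.card H'))
    {g : Perm H} {g' : Perm H'} (hg : ∀ x, g (g x) = x) (hgx : ∀ x, g x ≠ x)
    (hg' : ∀ x, g' (g' x) = x) (hgx' : ∀ x, g' x ≠ x)
    {f : Perm (H ⊕ H')} (hf : ∀ z, f (f z) = z) (hfx : ∀ z, f z ≠ z) :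
    symAvg p (Equiv.sumCongr g g') - 2 * L -
      Fintype.card H * (Fintype.card V / (L : ℝ) ^ 2 + 1 / (4 * L)) ≤ symAvg p f := by
  have hG : ∀ f : Perm (H ⊕ H'), (∀ z, f (f z) = z) → crossLeft f = ∅ →
      symAvg p (Equiv.sumCongr g g') ≤ symAvg p f := fun f hf hc =>
    symAvg_ge_of_crossLeft_eq_empty p hH hH' hg hgx hg' hgx' hf hc
  have hpos : 0 ≤ Fintype.card H * (Fintype.card V / (L : ℝ) ^ 2 + 1 / (4 * L)) := by positivity
  have hA : (freeLeft f).card = 0 := by simp [freeLeft, hfx]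
  have hB : (freeRight f).card = 0 := by simp [freeRight, hfx]
  by_cases hc : (crossLeft f).card ≤ 2 * L
  · obtain ⟨k, hk, h1, h2, h3, h4⟩ := exists_remove_cross p hf le_rfl
    have h5 := hG k hk (card_eq_zero.1 (by omega))
    have h6 : ((crossLeft f).card : ℝ) ≤ 2 * L := by exact_mod_cast hc
    linarith
  · obtain ⟨k, hk, h1, h2, h3, h4⟩ := exists_remove_cross p hf (le_of_not_ge hc)
    have h5 := symAvg_ge_potential p hL (symAvg_le_card p _) hG _ k hk rfl (by omega)
    have h6 : ((crossLeft k).card : ℝ) * (Fintype.card V / (L : ℝ) ^ 2 + 1 / (4 * L)) ≤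
        Fintype.card H * (Fintype.card V / (L : ℝ) ^ 2 + 1 / (4 * L)) := by
      gcongr
      exact card_le_univ _
    rw [h2, h3, hA, hB] at h5
    push_cast at h4
    simp only [sub_self, ne_eq, OfNat.ofNat_ne_zero, not_false_eq_true, zero_pow, zero_mul,
      sub_zero] at h5
    linarith

end symAvg

end PairingIndependence

section ConfigurationModel

open Equiv Finset

variable {N N₁ N₂ r : ℕ}

/-- A perfect matching as a permutation of the half-edges. -/
def Matching.toPerm (f : Matching N r) : Perm (Fin N × Fin r) :=
  Function.Involutive.toPerm f.1 f.2.1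

lemma maxIndepReg_eq_indepNumFor (f : Matching N r) :
    maxIndepReg f = indepNumFor Prod.fst f.toPerm := by
  unfold maxIndepReg indepNumFor
  congr 1
  ext S
  simp only [Finset.mem_filter, mem_univ, true_and, IsIndepFor]
  exact forall_congr' fun h => ⟨fun H _ => H, fun H => H (f.2.2 h)⟩

/-- Relabelling the half-edges of a perfect matching. -/
def Matching.conj (δ : Perm (Fin N × Fin r)) : Matching N r ≃ Matching N r where
  toFun f := ⟨fun x => δ (f.1 (δ.symm x)), fun x => by simp [f.2.1], fun x h => by
    rw [← Equiv.eq_symm_apply] at h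
    exact f.2.2 _ h⟩
  invFun f := ⟨fun x => δ.symm (f.1 (δ x)), fun x => by simp [f.2.1], fun x h => by
    rw [Equiv.symm_apply_eq] at h
    exact f.2.2 _ h⟩
  left_inv f := by ext x : 2; simp
  right_inv f := by ext x : 2; simp

lemma sum_indepNumFor_comp_perm (δ : Perm (Fin N × Fin r)) :
    ∑ f : Matching N r, (indepNumFor (Prod.fst ∘ δ) f.toPerm : ℝ) =
      ∑ f : Matching N r, (maxIndepReg f : ℝ) := by
  rw [← Equiv.sum_comp (Matching.conj δ) fun f : Matching N r => (maxIndepReg f : ℝ)]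
  refine sum_congr rfl fun f _ => ?_
  rw [maxIndepReg_eq_indepNumFor, ← indepNumFor_permCongr]
  rfl

lemma Matching.nonempty (h : Even (N * r)) : Nonempty (Matching N r) := by
  obtain ⟨g, h1, h2, -⟩ := exists_extend_involution (X := Fin N × Fin r) (by simpa using h) 1
    (by simp)
  exact ⟨⟨g, h1, h2⟩⟩

/-- The half-edges of the first `N₁` vertices and those of the last `N₂` vertices. -/
def splitHalfEdges (N₁ N₂ r : ℕ) :
    Fin (N₁ + N₂) × Fin r ≃ (Fin N₁ × Fin r) ⊕ (Fin N₂ × Fin r) :=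
  (finSumFinEquiv.symm.prodCongr (Equiv.refl _)).trans (Equiv.sumProdDistrib _ _ _)

lemma finSumFinEquiv_comp_map_fst :
    (finSumFinEquiv ∘ Sum.map Prod.fst Prod.fst : (Fin N₁ × Fin r) ⊕ (Fin N₂ × Fin r) → _) =
      Prod.fst ∘ (splitHalfEdges N₁ N₂ r).symm := by
  ext x
  rcases x with x | x <;> simp [splitHalfEdges]

lemma sum_symAvg_le :
    ∑ f : Matching (N₁ + N₂) r, symAvg
      (Sum.map Prod.fst Prod.fst : (Fin N₁ × Fin r) ⊕ (Fin N₂ × Fin r) → Fin N₁ ⊕ Fin N₂)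
      ((splitHalfEdges N₁ N₂ r).permCongr f.toPerm) ≤
    ∑ f : Matching (N₁ + N₂) r, (maxIndepReg f : ℝ) := by
  refine sum_symAvg_le_of_forall _ _ fun γ => le_of_eq ?_
  rw [← sum_indepNumFor_comp_perm (((splitHalfEdges N₁ N₂ r).trans
    (Equiv.sumCongr γ.1 γ.2)).trans (splitHalfEdges N₁ N₂ r).symm)]
  refine sum_congr rfl fun f _ => ?_
  rw [indepNumFor_permCongr, ← indepNumFor_comp_equiv _ finSumFinEquiv, ← Function.comp_assoc,
    ← Function.comp_assoc, finSumFinEquiv_comp_map_fst]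
  rfl

lemma le_sum_symAvg :
    (Fintype.card (Matching N₂ r) : ℝ) * ∑ f : Matching N₁ r, (maxIndepReg f : ℝ) +
      (Fintype.card (Matching N₁ r) : ℝ) * ∑ f : Matching N₂ r, (maxIndepReg f : ℝ) ≤
    ∑ f : Matching N₁ r × Matching N₂ r, symAvg
      (Sum.map Prod.fst Prod.fst : (Fin N₁ × Fin r) ⊕ (Fin N₂ × Fin r) → Fin N₁ ⊕ Fin N₂)
      (Equiv.sumCongr f.1.toPerm f.2.toPerm) := by
  refine le_sum_symAvg_of_forall _ _ fun γ => ?_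
  rw [← sum_indepNumFor_comp_perm γ.1, ← sum_indepNumFor_comp_perm γ.2]
  calc _ = ∑ f : Matching N₁ r × Matching N₂ r,
        ((indepNumFor (Prod.fst ∘ γ.1) f.1.toPerm : ℝ) +
          indepNumFor (Prod.fst ∘ γ.2) f.2.toPerm) := by
        rw [Fintype.sum_prod_type]
        simp only [sum_add_distrib, sum_const, card_univ, nsmul_eq_mul, mul_sum]
    _ ≤ _ := sum_le_sum fun f _ => by
        rw [Sum.map_comp_map]
        exact_mod_cast indepNumFor_sum_le (Prod.fst ∘ γ.1) (Prod.fst ∘ γ.2) f.1.toPerm f.2.toPerm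

lemma expReg_superadditive {L : ℕ} (hL : 1 ≤ L) (h₁ : Even (N₁ * r)) (h₂ : Even (N₂ * r)) :
    expReg N₁ r (fun f => (maxIndepReg f : ℝ)) + expReg N₂ r (fun f => (maxIndepReg f : ℝ)) -
      (2 * L + N₁ * r * ((N₁ + N₂) / (L : ℝ) ^ 2 + 1 / (4 * L))) ≤
    expReg (N₁ + N₂) r (fun f => (maxIndepReg f : ℝ)) := by
  have := Matching.nonempty h₁
  have := Matching.nonempty h₂
  have : Nonempty (Matching (N₁ + N₂) r) := Matching.nonempty (by rw [add_mul]; exact h₁.add h₂)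
  have hM : (0 : ℝ) < Fintype.card (Matching (N₁ + N₂) r) := by exact_mod_cast Fintype.card_pos
  have hM₁ : (0 : ℝ) < Fintype.card (Matching N₁ r) := by exact_mod_cast Fintype.card_pos
  have hM₂ : (0 : ℝ) < Fintype.card (Matching N₂ r) := by exact_mod_cast Fintype.card_pos
  set E : ℝ := 2 * L + N₁ * r * ((N₁ + N₂) / (L : ℝ) ^ 2 + 1 / (4 * L)) with hE
  have key : ∀ (f : Matching (N₁ + N₂) r) (g : Matching N₁ r × Matching N₂ r),
      symAvg (Sum.map Prod.fst Prod.fst :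
        (Fin N₁ × Fin r) ⊕ (Fin N₂ × Fin r) → Fin N₁ ⊕ Fin N₂)
        (Equiv.sumCongr g.1.toPerm g.2.toPerm) - E ≤
      symAvg (Sum.map Prod.fst Prod.fst) ((splitHalfEdges N₁ N₂ r).permCongr f.toPerm) := by
    intro f g
    have h := symAvg_ge_of_perfect (Sum.map Prod.fst Prod.fst :
        (Fin N₁ × Fin r) ⊕ (Fin N₂ × Fin r) → Fin N₁ ⊕ Fin N₂) hL (by simpa using h₁)
      (by simpa using h₂) (g := g.1.toPerm) (g' := g.2.toPerm) g.1.2.1 g.1.2.2 g.2.2.1 g.2.2.2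
      (f := (splitHalfEdges N₁ N₂ r).permCongr f.toPerm)
      (fun z => by
        simp only [Equiv.permCongr_apply, Equiv.symm_apply_apply]
        exact (congrArg _ (f.2.1 _)).trans (Equiv.apply_symm_apply _ z))
      (fun z hz => by
        have := f.2.2 ((splitHalfEdges N₁ N₂ r).symm z)
        rw [Equiv.permCongr_apply, ← Equiv.eq_symm_apply] at hz
        exact this hz)
    simp only [Fintype.card_sum, Fintype.card_prod, Fintype.card_fin] at h
    push_cast at h
    rw [hE]
    linarith
  have h1 : ∀ f : Matching (N₁ + N₂) r,
      expReg N₁ r (fun f => (maxIndepReg f : ℝ)) + expReg N₂ r (fun f => (maxIndepReg f : ℝ)) - E ≤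
      symAvg (Sum.map Prod.fst Prod.fst :
        (Fin N₁ × Fin r) ⊕ (Fin N₂ × Fin r) → Fin N₁ ⊕ Fin N₂)
        ((splitHalfEdges N₁ N₂ r).permCongr f.toPerm) := by
    intro f
    have h2 := le_sum_symAvg.trans (sum_le_sum fun g _ => sub_le_iff_le_add.1 (key f g))
    rw [sum_const, card_univ, Fintype.card_prod, nsmul_eq_mul, Nat.cast_mul] at h2
    unfold expReg
    rw [sub_le_iff_le_add, div_add_div _ _ hM₁.ne' hM₂.ne', div_le_iff₀ (by positivity)]
    linarith
  rw [expReg.eq_def (N₁ + N₂), le_div_iff₀ hM]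
  refine le_trans ?_ sum_symAvg_le
  rw [mul_comm, ← nsmul_eq_mul, ← card_univ]
  exact card_nsmul_le_sum _ _ _ fun f _ => h1 f

end ConfigurationModel

/-- Near-superadditivity of the expected independence number of the configuration-model
random `r`-regular multigraph: there is a constant `C = C(r)` such that
`E[I(G(N,r))] ≥ E[I(G(N₁,r))] + E[I(G(N₂,r))] − C N^{5/6}` whenever `N = N₁ + N₂` with
`N₁ r` and `N₂ r` even. -/
theorem indep_set_interpolation_regular (r : ℕ) (hr : 1 ≤ r) :
    ∃ C : ℝ, ∀ N N₁ N₂ : ℕ, 1 ≤ N₁ → 1 ≤ N₂ → N₁ + N₂ = N →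
      Even (N₁ * r) → Even (N₂ * r) →
      expReg N r (fun f => (maxIndepReg f : ℝ)) ≥
        expReg N₁ r (fun f => (maxIndepReg f : ℝ)) +
          expReg N₂ r (fun f => (maxIndepReg f : ℝ)) -
          C * (N : ℝ) ^ ((5 : ℝ) / 6) := by
  refine ⟨4 + 2 * r, ?_⟩
  rintro N N₁ N₂ hN₁ hN₂ rfl h₁ h₂
  set t : ℝ := ((N₁ + N₂ : ℕ) : ℝ) ^ ((1 : ℝ) / 3) with ht
  have hN1 : (1 : ℝ) ≤ ((N₁ + N₂ : ℕ) : ℝ) := by exact_mod_cast (by omega)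
  have ht1 : 1 ≤ t := Real.one_le_rpow hN1 (by norm_num)
  have ht3 : t ^ 3 = ((N₁ + N₂ : ℕ) : ℝ) := by
    rw [ht, ← Real.rpow_natCast, ← Real.rpow_mul (by positivity)]
    norm_num
  have ht2 : t ^ 2 ≤ ((N₁ + N₂ : ℕ) : ℝ) ^ ((5 : ℝ) / 6) := by
    rw [ht, ← Real.rpow_natCast, ← Real.rpow_mul (by positivity)]
    exact Real.rpow_le_rpow_of_exponent_le hN1 (by norm_num)
  have hL : t ^ 2 ≤ (⌈t ^ 2⌉₊ : ℝ) := Nat.le_ceil _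
  have hL1 : 1 ≤ ⌈t ^ 2⌉₊ := Nat.one_le_ceil_iff.2 (by positivity)
  have hL2 : (⌈t ^ 2⌉₊ : ℝ) < t ^ 2 + 1 := Nat.ceil_lt_add_one (by positivity)
  have hmain := expReg_superadditive hL1 h₁ h₂
  generalize ⌈t ^ 2⌉₊ = L at *
  push_cast at ht3
  have hN₁t : (N₁ : ℝ) ≤ t ^ 3 := by rw [ht3]; linarith [(Nat.cast_nonneg N₂ : (0 : ℝ) ≤ N₂)]
  have e1 : (N₁ : ℝ) * r * ((N₁ + N₂) / (L : ℝ) ^ 2 + 1 / (4 * L)) ≤ 2 * r * t ^ 2 := by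
    calc (N₁ : ℝ) * r * ((N₁ + N₂) / (L : ℝ) ^ 2 + 1 / (4 * L))
        ≤ t ^ 3 * r * (t ^ 3 / (t ^ 2) ^ 2 + 1 / (4 * t ^ 2)) := by
          rw [← ht3]; gcongr
      _ = r * (t ^ 2 + t / 4) := by field_simp
      _ ≤ 2 * r * t ^ 2 := by
          have : t ^ 2 + t / 4 ≤ 2 * t ^ 2 := by nlinarith
          nlinarith [(Nat.cast_nonneg r : (0 : ℝ) ≤ r)]
  have e2 : 2 * (L : ℝ) ≤ 4 * t ^ 2 := by nlinarith
  have e3 : (4 + 2 * (r : ℝ)) * t ^ 2 ≤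
      (4 + 2 * (r : ℝ)) * ((N₁ + N₂ : ℕ) : ℝ) ^ ((5 : ℝ) / 6) := by gcongr
  linarith
end
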